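/- arXiv:1504.06143 — 7 statements merged into one kernel-verified Lean document; each statement's English description precedes it below -/
import Mathlib

section
/- Reverse Hölder inequality for matrices: Let f ∈ M_d be positive semidefinite and g ∈ M_d be positive definite, and let p, p' be real numbers with 0 < p ≤ 1, p ≠ 1 when needed so that 1/p + 1/p' = 1 holds with p' < 0 (for p = 1 take the statement with p' interpreted via the limit, i.e. τ(fg) ≥ ‖f‖_1 · λ_min-type bound is not required; it suffices to prove the case 0 < p < 1, p' = p/(p−1) < 0). Then τ(fg) ≥ ‖f‖_p ‖g‖_{p'}, where τ(h) = Tr(h)/d is the normalized trace. -/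
open Matrix
open scoped ComplexOrder

noncomputable section

/-- Apply a real function to a Hermitian matrix via the functional calculus
(junk value `0` on non-Hermitian matrices). -/
def hermFC {ι : Type*} [Fintype ι] [DecidableEq ι] (φ : ℝ → ℝ)
    (f : Matrix ι ι ℂ) : Matrix ι ι ℂ :=
  if hf : f.IsHermitian then
    (hf.eigenvectorUnitary : Matrix ι ι ℂ) *
      Matrix.diagonal (fun i => (φ (hf.eigenvalues i) : ℂ)) *
      (star hf.eigenvectorUnitary : Matrix ι ι ℂ)
  else 0

/-- Real matrix powers of a Hermitian matrix, via the functional calculus on eigenvalues. -/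
def mpow {ι : Type*} [Fintype ι] [DecidableEq ι] (f : Matrix ι ι ℂ) (a : ℝ) :
    Matrix ι ι ℂ :=
  hermFC (fun x => x ^ a) f

/-- The normalized trace `τ(f) = Tr f / d` (real part). -/
def ntrace {ι : Type*} [Fintype ι] [DecidableEq ι] (f : Matrix ι ι ℂ) : ℝ :=
  (f.trace).re / (Fintype.card ι)

/-- Normalized Schatten p-'norm': `‖f‖_p = ((1/d) Tr |f|^p)^(1/p)` with `|f| = √(f† f)`. -/
def snorm {ι : Type*} [Fintype ι] [DecidableEq ι] (p : ℝ) (f : Matrix ι ι ℂ) : ℝ :=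
  (ntrace (mpow (fᴴ * f) (p / 2))) ^ (1 / p)

/-- The entropy `Ent(f) = τ(f ln f) − τ(f) ln τ(f)`. -/
def mEnt {ι : Type*} [Fintype ι] [DecidableEq ι] (f : Matrix ι ι ℂ) : ℝ :=
  ntrace (hermFC (fun x => x * Real.log x) f) - ntrace f * Real.log (ntrace f)

/-- The Dirichlet form `E_L(f,g) = τ(f L(g))`. -/
def dirichlet {ι : Type*} [Fintype ι] [DecidableEq ι]
    (L : Matrix ι ι ℂ → Matrix ι ι ℂ) (f g : Matrix ι ι ℂ) : ℝ :=
  ntrace (f * L g)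

/-- Complete positivity: every matrix extension `id_m ⊗ T` maps PSD matrices to PSD matrices. -/
def IsCompletelyPositive {ι : Type*} [Fintype ι] [DecidableEq ι]
    (T : Matrix ι ι ℂ → Matrix ι ι ℂ) : Prop :=
  ∀ (m : ℕ) (M : Matrix (Fin m × ι) (Fin m × ι) ℂ), M.PosSemidef →
    (Matrix.of fun p q : Fin m × ι =>
      T (Matrix.of fun i j : ι => M (p.1, i) (q.1, j)) p.2 q.2).PosSemidef

/-- A quantum channel: a linear, completely positive, trace-preserving map. -/
def IsQChannel {ι : Type*} [Fintype ι] [DecidableEq ι]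
    (T : Matrix ι ι ℂ → Matrix ι ι ℂ) : Prop :=
  IsLinearMap ℂ T ∧ IsCompletelyPositive T ∧ ∀ f, (T f).trace = f.trace

/-- Reversibility (detailed balance w.r.t. the trace): `τ(f T(g)) = τ(T(f) g)`. -/
def IsReversible {ι : Type*} [Fintype ι] [DecidableEq ι]
    (T : Matrix ι ι ℂ → Matrix ι ι ℂ) : Prop :=
  ∀ f g : Matrix ι ι ℂ, (f * T g).trace = (T f * g).trace

/-- Primitivity: iterates of `T` converge on every density matrix to a fixed
full-rank state independent of the input. -/
def IsPrimitive {ι : Type*} [Fintype ι] [DecidableEq ι]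
    (T : Matrix ι ι ℂ → Matrix ι ι ℂ) : Prop :=
  ∃ σ : Matrix ι ι ℂ, σ.PosDef ∧ σ.trace = 1 ∧
    ∀ ρ : Matrix ι ι ℂ, ρ.PosSemidef → ρ.trace = 1 →
      Filter.Tendsto (fun k => T^[k] ρ) Filter.atTop (nhds σ)

/-- The depolarizing channel with parameter `γ` applied to the `k`-th qubit of `n` qubits:
`D_γ(f) = γ f + (1−γ) (tr_k f) ⊗_k (I/2)`. -/
def depolAt {n : ℕ} (γ : ℝ) (k : Fin n)
    (f : Matrix (Fin n → Fin 2) (Fin n → Fin 2) ℂ) :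
    Matrix (Fin n → Fin 2) (Fin n → Fin 2) ℂ :=
  Matrix.of fun x y =>
    (γ : ℂ) * f x y +
      ((1 - γ : ℝ) : ℂ) *
        (if x k = y k then
          (1 / 2) * ∑ b : Fin 2, f (Function.update x k b) (Function.update y k b)
        else 0)

/-- The tensor power `D_γ^{⊗n}` of the qubit depolarizing channel, acting on `n` qubits. -/
def depolChannel {n : ℕ} (γ : ℝ)
    (f : Matrix (Fin n → Fin 2) (Fin n → Fin 2) ℂ) :
    Matrix (Fin n → Fin 2) (Fin n → Fin 2) ℂ :=
  (List.finRange n).foldl (fun g k => depolAt γ k g) f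

/-- The semigroup element `e^{−tL}` applied to `f`, defined by its power series. -/
def opExp {ι : Type*} [Fintype ι] [DecidableEq ι]
    (L : Matrix ι ι ℂ → Matrix ι ι ℂ) (t : ℝ) (f : Matrix ι ι ℂ) : Matrix ι ι ℂ :=
  ∑' k : ℕ, (((-t) ^ k / (Nat.factorial k) : ℝ) : ℂ) • L^[k] f

/-- The classical noise operator `T_γ` on functions on the boolean cube:
each bit is flipped independently with probability `(1−γ)/2`. -/
def noiseOp {n : ℕ} (γ : ℝ) (f : (Fin n → Fin 2) → ℝ) : (Fin n → Fin 2) → ℝ :=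
  fun x => ∑ y : Fin n → Fin 2,
    (∏ i : Fin n, if y i = x i then (1 + γ) / 2 else (1 - γ) / 2) * f y

/-- The normalized `ℓ_p` 'norm' `‖f‖_p = (2^{-n} Σ_x |f(x)|^p)^{1/p}` on the boolean cube. -/
def lpnorm {n : ℕ} (p : ℝ) (f : (Fin n → Fin 2) → ℝ) : ℝ :=
  ((∑ x : Fin n → Fin 2, |f x| ^ p) / 2 ^ n) ^ (1 / p)

end

/-- Weighted reverse Hölder inequality for finite sums, with exponents `0 < p < 1` and
`q = p / (p - 1) < 0`. -/
theorem rpow_sum_mul_rpow_sum_le_sum_mul {κ : Type*} (s : Finset κ) (w x y : κ → ℝ)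
    (hw : ∀ i ∈ s, 0 ≤ w i) (hx : ∀ i ∈ s, 0 ≤ x i) (hy : ∀ i ∈ s, 0 < y i)
    {p q : ℝ} (hp0 : 0 < p) (hp1 : p < 1) (hq : q = p / (p - 1)) :
    (∑ i ∈ s, w i * x i ^ p) ^ (1 / p) * (∑ i ∈ s, w i * y i ^ q) ^ (1 / q) ≤
      ∑ i ∈ s, w i * (x i * y i) := by
  have hp1' : 0 < 1 - p := by linarith
  have hqp : q * (1 - p) = -p := by
    have : p - 1 ≠ 0 := by linarith
    rw [hq]; field_simp; ring
  have hqinv : 1 / q = -((1 - p) * (1 / p)) := by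
    have : p - 1 ≠ 0 := by linarith
    rw [hq]; field_simp; ring
  have hwxy : ∀ i ∈ s, 0 ≤ w i * (x i * y i) := fun i hi =>
    mul_nonneg (hw i hi) (mul_nonneg (hx i hi) (hy i hi).le)
  have hwy : ∀ i ∈ s, 0 ≤ w i * y i ^ q := fun i hi =>
    mul_nonneg (hw i hi) (Real.rpow_nonneg (hy i hi).le _)
  have hwx : ∀ i ∈ s, 0 ≤ w i * x i ^ p := fun i hi =>
    mul_nonneg (hw i hi) (Real.rpow_nonneg (hx i hi) _)
  have hconj : (1 / p).HolderConjugate (1 / (1 - p)) := by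
    rw [Real.holderConjugate_iff]
    refine ⟨by rw [lt_div_iff₀ hp0]; linarith, by simp⟩
  have key := Real.inner_le_Lp_mul_Lq_of_nonneg s (f := fun i => (w i * (x i * y i)) ^ p)
    (g := fun i => (w i * y i ^ q) ^ (1 - p)) hconj
    (fun i hi => Real.rpow_nonneg (hwxy i hi) _) (fun i hi => Real.rpow_nonneg (hwy i hi) _)
  have hprod : ∑ i ∈ s, (w i * (x i * y i)) ^ p * (w i * y i ^ q) ^ (1 - p) =
      ∑ i ∈ s, w i * x i ^ p := by
    refine Finset.sum_congr rfl fun i hi => ?_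
    have hyi := hy i hi
    rw [Real.mul_rpow (hw i hi) (mul_nonneg (hx i hi) hyi.le), Real.mul_rpow (hx i hi) hyi.le,
      Real.mul_rpow (hw i hi) (Real.rpow_nonneg hyi.le _), ← Real.rpow_mul hyi.le, hqp,
      Real.rpow_neg hyi.le]
    have hwp : w i ^ p * w i ^ (1 - p) = w i := by
      rw [← Real.rpow_add' (hw i hi) (by simp)]; simp
    have hyp : y i ^ p ≠ 0 := (Real.rpow_pos_of_pos hyi _).ne'
    calc _ = (w i ^ p * w i ^ (1 - p)) * x i ^ p * (y i ^ p * (y i ^ p)⁻¹) := by ring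
      _ = w i * x i ^ p := by rw [hwp, mul_inv_cancel₀ hyp, mul_one]
  have hf : ∑ i ∈ s, ((w i * (x i * y i)) ^ p) ^ (1 / p) = ∑ i ∈ s, w i * (x i * y i) :=
    Finset.sum_congr rfl fun i hi => by
      rw [← Real.rpow_mul (hwxy i hi), mul_one_div_cancel hp0.ne', Real.rpow_one]
  have hg : ∑ i ∈ s, ((w i * y i ^ q) ^ (1 - p)) ^ (1 / (1 - p)) = ∑ i ∈ s, w i * y i ^ q :=
    Finset.sum_congr rfl fun i hi => by
      rw [← Real.rpow_mul (hwy i hi), mul_one_div_cancel hp1'.ne', Real.rpow_one]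
  rw [hprod, hf, hg, one_div_one_div, one_div_one_div] at key
  have hS := Finset.sum_nonneg hwxy
  have hA := Finset.sum_nonneg hwx
  have hB := Finset.sum_nonneg hwy
  generalize ∑ i ∈ s, w i * (x i * y i) = S at *
  generalize ∑ i ∈ s, w i * x i ^ p = A at *
  generalize ∑ i ∈ s, w i * y i ^ q = B at *
  rcases hB.eq_or_lt with rfl | hB
  · have : (1 : ℝ) / q ≠ 0 := by
      rw [hqinv]; exact neg_ne_zero.2 (by positivity)
    rwa [Real.zero_rpow this, mul_zero]
  · have h := Real.rpow_le_rpow hA key (z := 1 / p) (by positivity)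
    rw [Real.mul_rpow (by positivity) (by positivity), ← Real.rpow_mul hS,
      mul_one_div_cancel hp0.ne', Real.rpow_one, ← Real.rpow_mul hB.le] at h
    rw [hqinv, Real.rpow_neg hB.le, ← div_eq_mul_inv, div_le_iff₀ (by positivity)]
    exact h

section

variable {ι : Type*} [Fintype ι] [DecidableEq ι]

theorem Matrix.IsHermitian.eq_mul_diagonal_mul {A : Matrix ι ι ℂ} (hA : A.IsHermitian) :
    A = (hA.eigenvectorUnitary : Matrix ι ι ℂ) *
      diagonal (fun i => (hA.eigenvalues i : ℂ)) * (hA.eigenvectorUnitary : Matrix ι ι ℂ)ᴴ := by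
  conv_lhs => rw [hA.spectral_theorem, Unitary.conjStarAlgAut_apply]
  rfl

/-- The trace of a function of a Hermitian matrix only depends on the roots of its characteristic
polynomial. -/
theorem ntrace_hermFC_of_charpoly_eq (φ : ℝ → ℝ) {A : Matrix ι ι ℂ} (hA : A.IsHermitian)
    (a : ι → ℝ) (h : A.charpoly = ∏ i, (Polynomial.X - Polynomial.C (a i : ℂ))) :
    ntrace (hermFC φ A) = (∑ i, φ (a i)) / Fintype.card ι := by
  have hroots : A.charpoly.roots = Finset.univ.val.map (fun i => (a i : ℂ)) := by
    rw [h, Polynomial.roots_prod]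
    · simp
    · simp [Finset.prod_ne_zero_iff, Polynomial.X_sub_C_ne_zero]
  have hsum : ∑ i, φ (hA.eigenvalues i) = ∑ i, φ (a i) := by
    have := congrArg (fun m => (m.map fun z : ℂ => φ z.re).sum)
      (hA.roots_charpoly_eq_eigenvalues.symm.trans hroots)
    simpa [Multiset.map_map, Function.comp_def] using this
  rw [ntrace, hermFC, dif_pos hA, Matrix.trace_mul_comm, ← mul_assoc, Unitary.coe_star_mul_self,
    one_mul, Matrix.trace_diagonal, ← hsum]
  simp

theorem Matrix.IsHermitian.charpoly_conjTranspose_mul_self {A : Matrix ι ι ℂ}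
    (hA : A.IsHermitian) :
    (Aᴴ * A).charpoly =
      ∏ i, (Polynomial.X - Polynomial.C ((hA.eigenvalues i ^ 2 : ℝ) : ℂ)) := by
  have hU : (hA.eigenvectorUnitary : Matrix ι ι ℂ)ᴴ * hA.eigenvectorUnitary = 1 :=
    Unitary.coe_star_mul_self _
  rw [hA.eq]
  conv_lhs =>
    rw [hA.eq_mul_diagonal_mul, ← mul_assoc, Matrix.charpoly_mul_comm]
  simp only [← mul_assoc, hU, one_mul]
  rw [mul_assoc (diagonal _), hU, mul_one, diagonal_mul_diagonal, charpoly_diagonal]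
  simp [sq]

theorem snorm_eq_of_posSemidef {A : Matrix ι ι ℂ} (hA : A.PosSemidef) (p : ℝ) :
    snorm p A = ((∑ i, hA.1.eigenvalues i ^ p) / Fintype.card ι) ^ (1 / p) := by
  rw [snorm, mpow, ntrace_hermFC_of_charpoly_eq _ (isHermitian_conjTranspose_mul_self A) _
    hA.1.charpoly_conjTranspose_mul_self]
  congr 2
  refine Finset.sum_congr rfl fun i _ => ?_
  rw [← Real.rpow_natCast, ← Real.rpow_mul (hA.eigenvalues_nonneg i)]
  congr 1
  push_cast
  ring

/-- The trace of a product of Hermitian matrices is a doubly stochastic average of the products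
of their eigenvalues. -/
theorem exists_doublyStochastic_trace_mul {A B : Matrix ι ι ℂ} (hA : A.IsHermitian)
    (hB : B.IsHermitian) :
    ∃ w ∈ doublyStochastic ℝ ι, (A * B).trace.re =
      ∑ i, ∑ j, w i j * (hA.eigenvalues i * hB.eigenvalues j) := by
  set U := (hA.eigenvectorUnitary : Matrix ι ι ℂ) with hUdef
  set V := (hB.eigenvectorUnitary : Matrix ι ι ℂ) with hVdef
  have hU : Uᴴ * U = 1 := Unitary.coe_star_mul_self _
  have hU' : U * Uᴴ = 1 := Unitary.coe_mul_star_self _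
  have hV : Vᴴ * V = 1 := Unitary.coe_star_mul_self _
  have hV' : V * Vᴴ = 1 := Unitary.coe_mul_star_self _
  set W : Matrix ι ι ℂ := Uᴴ * V with hW
  have hWW : W * Wᴴ = 1 := by
    rw [hW, conjTranspose_mul, conjTranspose_conjTranspose, mul_assoc, ← mul_assoc V, hV', one_mul,
      hU]
  have hWW' : Wᴴ * W = 1 := by
    rw [hW, conjTranspose_mul, conjTranspose_conjTranspose, mul_assoc, ← mul_assoc U, hU', one_mul,
      hV]
  refine ⟨Matrix.of fun i j => Complex.normSq (W i j), ?_, ?_⟩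
  · rw [mem_doublyStochastic_iff_sum]
    refine ⟨fun i j => Complex.normSq_nonneg _, fun i => ?_, fun j => ?_⟩
    · have := congrFun (congrFun hWW i) i
      rw [mul_apply, one_apply_eq] at this
      simpa [Complex.mul_conj] using congrArg Complex.re this
    · have := congrFun (congrFun hWW' j) j
      rw [mul_apply, one_apply_eq] at this
      simpa [← Complex.normSq_eq_conj_mul_self] using congrArg Complex.re this
  · have h : (A * B).trace = (diagonal (fun i => (hA.eigenvalues i : ℂ)) * W *
        (diagonal (fun i => (hB.eigenvalues i : ℂ)) * Wᴴ)).trace := by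
      conv_lhs => rw [hA.eq_mul_diagonal_mul, hB.eq_mul_diagonal_mul]
      rw [← hUdef, ← hVdef, hW, conjTranspose_mul, conjTranspose_conjTranspose]
      simp only [mul_assoc]
      rw [Matrix.trace_mul_comm]
      simp only [mul_assoc]
    rw [h, trace, Complex.re_sum]
    refine Finset.sum_congr rfl fun i _ => ?_
    rw [diag_apply, mul_apply, Complex.re_sum]
    refine Finset.sum_congr rfl fun j _ => ?_
    rw [diagonal_mul, diagonal_mul, conjTranspose_apply, of_apply]
    have : (hA.eigenvalues i : ℂ) * W i j * (hB.eigenvalues j * star (W i j)) =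
        ((Complex.normSq (W i j) * (hA.eigenvalues i * hB.eigenvalues j) : ℝ) : ℂ) := by
      push_cast
      rw [← Complex.mul_conj, Complex.star_def]
      ring
    rw [this, Complex.ofReal_re]

end

/-- Reverse Hölder inequality for matrices, for `0 < p < 1` with
Hölder conjugate `p' = p/(p−1) < 0`. -/
theorem reverse_holder
    (d : ℕ) (hd : 0 < d)
    (f g : Matrix (Fin d) (Fin d) ℂ) (hf : f.PosSemidef) (hg : g.PosDef)
    (p p' : ℝ) (hp0 : 0 < p) (hp1 : p < 1) (hp' : p' = p / (p - 1)) :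
    snorm p f * snorm p' g ≤ ntrace (f * g) := by
  obtain ⟨w, hw, htr⟩ := exists_doublyStochastic_trace_mul hf.1 hg.1
  rw [mem_doublyStochastic_iff_sum] at hw
  obtain ⟨hw0, hrow, hcol⟩ := hw
  have key := rpow_sum_mul_rpow_sum_le_sum_mul (Finset.univ : Finset (Fin d × Fin d))
    (fun k => w k.1 k.2 / d) (fun k => hf.1.eigenvalues k.1) (fun k => hg.1.eigenvalues k.2)
    (fun k _ => div_nonneg (hw0 _ _) (Nat.cast_nonneg d)) (fun k _ => hf.eigenvalues_nonneg _)
    (fun k _ => hg.eigenvalues_pos _) hp0 hp1 hp'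
  rw [snorm_eq_of_posSemidef hf, snorm_eq_of_posSemidef hg.posSemidef, ntrace, htr]
  simp only [Fintype.card_fin]
  convert key using 3
  · rw [Fintype.sum_prod_type, Finset.sum_div]
    refine Finset.sum_congr rfl fun i _ => ?_
    simp only [← Finset.sum_mul, ← Finset.sum_div, hrow]
    ring
  · rw [Fintype.sum_prod_type_right, Finset.sum_div]
    refine Finset.sum_congr rfl fun j _ => ?_
    simp only [← Finset.sum_mul, ← Finset.sum_div, hcol]
    ring
  · rw [Fintype.sum_prod_type, Finset.sum_div]
    refine Finset.sum_congr rfl fun i _ => ?_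
    rw [Finset.sum_div]
    exact Finset.sum_congr rfl fun j _ => by ring
end

section
/- Reverse Minkowski inequality for matrices: Let f, g ∈ M_d be positive semidefinite matrices and let p < 1, p ≠ 0 (if p < 0, assume f and g are positive definite). Then ‖f + g‖_p ≥ ‖f‖_p + ‖g‖_p. -/
open Matrix
open scoped ComplexOrder

/-- The function `x ↦ x ^ p` is convex on the positive reals for `p ≤ 0`. -/
theorem convexOn_rpow_of_nonpos {p : ℝ} (hp : p ≤ 0) :
    ConvexOn ℝ (Set.Ioi 0) fun x : ℝ => x ^ p := by
  have hlog : ConvexOn ℝ (Set.Ioi 0) fun x : ℝ => p * Real.log x := by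
    simpa using (strictConcaveOn_log_Ioi.concaveOn.neg).smul (neg_nonneg.2 hp)
  refine ⟨convex_Ioi 0, fun x hx y hy a b ha hb hab => ?_⟩
  have hxy : (0 : ℝ) < a • x + b • y := convex_Ioi 0 hx hy ha hb hab
  simp only [Real.rpow_def_of_pos hxy, Real.rpow_def_of_pos (Set.mem_Ioi.1 hx),
    Real.rpow_def_of_pos (Set.mem_Ioi.1 hy), mul_comm _ p]
  exact (Real.exp_le_exp.2 (hlog.2 hx hy ha hb hab)).trans
    (convexOn_exp.2 (Set.mem_univ _) (Set.mem_univ _) ha hb hab)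

/-- A convex function decreases in sum when its arguments are averaged by a doubly stochastic
matrix. -/
theorem ConvexOn.sum_mulVec_le {ι : Type*} [Fintype ι] {s : Set ℝ} {φ : ℝ → ℝ}
    (hφ : ConvexOn ℝ s φ) {W : Matrix ι ι ℝ} (hW : ∀ i j, 0 ≤ W i j)
    (hrow : ∀ i, ∑ j, W i j = 1) (hcol : ∀ j, ∑ i, W i j = 1) {x : ι → ℝ} (hx : ∀ i, x i ∈ s) :
    ∑ i, φ (∑ j, W i j * x j) ≤ ∑ i, φ (x i) :=
  calc ∑ i, φ (∑ j, W i j * x j) ≤ ∑ i, ∑ j, W i j * φ (x j) :=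
        Finset.sum_le_sum fun i _ => by
          simpa using hφ.map_sum_le (t := Finset.univ) (w := W i) (p := x)
            (fun j _ => hW i j) (hrow i) (fun j _ => hx j)
    _ = ∑ i, φ (x i) := by
        rw [Finset.sum_comm]
        simp_rw [← Finset.sum_mul, hcol, one_mul]

/-- Minkowski-type inequality before taking the `p`-th root, where `c` is a sign chosen to make
`x ↦ c * x ^ p` convex. -/
theorem ConvexOn.mul_sum_add_rpow_le {ι : Type*} [Fintype ι] {s : Set ℝ} {c p : ℝ}
    (hs : ∀ x ∈ s, 0 ≤ x) (hsmul : ∀ x ∈ s, ∀ r : ℝ, 0 < r → x / r ∈ s)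
    (hφ : ConvexOn ℝ s fun x : ℝ => c * x ^ p) {a b : ι → ℝ} (ha : ∀ i, a i ∈ s)
    (hb : ∀ i, b i ∈ s) {A B : ℝ} (hA : 0 < A) (hB : 0 < B) (hAa : ∑ i, a i ^ p = A ^ p)
    (hBb : ∑ i, b i ^ p = B ^ p) :
    c * ∑ i, (a i + b i) ^ p ≤ c * (A + B) ^ p := by
  have hAB : 0 < A + B := add_pos hA hB
  have hpow : 0 < (A + B) ^ p := Real.rpow_pos_of_pos hAB p
  have key (i : ι) : c * (a i + b i) ^ p ≤
      (A + B) ^ p * (A / (A + B) * (c * (a i ^ p / A ^ p)) +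
        B / (A + B) * (c * (b i ^ p / B ^ p))) := by
    have h := hφ.2 (hsmul _ (ha i) A hA) (hsmul _ (hb i) B hB) (div_pos hA hAB).le
      (div_pos hB hAB).le (by field_simp)
    have hcomb : A / (A + B) * (a i / A) + B / (A + B) * (b i / B) = (a i + b i) / (A + B) := by
      field_simp
    simp only [smul_eq_mul, hcomb, Real.div_rpow (hs _ (ha i)) hA.le,
      Real.div_rpow (hs _ (hb i)) hB.le,
      Real.div_rpow (add_nonneg (hs _ (ha i)) (hs _ (hb i))) hAB.le] at h
    refine le_trans (le_of_eq ?_) (mul_le_mul_of_nonneg_left h hpow.le)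
    field_simp
  have hA' := (Real.rpow_pos_of_pos hA p).ne'
  have hB' := (Real.rpow_pos_of_pos hB p).ne'
  rw [Finset.mul_sum]
  refine (Finset.sum_le_sum fun i _ => key i).trans (le_of_eq ?_)
  rw [← Finset.mul_sum, Finset.sum_add_distrib, ← Finset.mul_sum, ← Finset.mul_sum,
    ← Finset.mul_sum, ← Finset.mul_sum, ← Finset.sum_div, ← Finset.sum_div, hAa, hBb,
    div_self hA', div_self hB']
  field_simp

/-- Reverse Minkowski inequality for finite sums, exponent in `(0, 1)`. -/
theorem reverse_minkowski_sum_of_pos {ι : Type*} [Fintype ι] {p : ℝ} (hp0 : 0 < p) (hp : p < 1)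
    {a b : ι → ℝ} (ha : ∀ i, 0 ≤ a i) (hb : ∀ i, 0 ≤ b i) :
    (∑ i, a i ^ p) ^ p⁻¹ + (∑ i, b i ^ p) ^ p⁻¹ ≤ (∑ i, (a i + b i) ^ p) ^ p⁻¹ := by
  have nonneg {x : ι → ℝ} (hx : ∀ i, 0 ≤ x i) : 0 ≤ ∑ i, x i ^ p :=
    Finset.sum_nonneg fun i _ => Real.rpow_nonneg (hx i) p
  have mono {x y : ι → ℝ} (hx : ∀ i, 0 ≤ x i) (hxy : ∀ i, x i ≤ y i) :
      (∑ i, x i ^ p) ^ p⁻¹ ≤ (∑ i, y i ^ p) ^ p⁻¹ :=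
    Real.rpow_le_rpow (nonneg hx)
      (Finset.sum_le_sum fun i _ => Real.rpow_le_rpow (hx i) (hxy i) hp0.le) (inv_pos.2 hp0).le
  have hab (i : ι) : 0 ≤ a i + b i := add_nonneg (ha i) (hb i)
  rcases (nonneg ha).eq_or_lt with h | hA
  · rw [← h, Real.zero_rpow (inv_pos.2 hp0).ne', zero_add]
    exact mono hb fun i => le_add_of_nonneg_left (ha i)
  rcases (nonneg hb).eq_or_lt with h | hB
  · rw [← h, Real.zero_rpow (inv_pos.2 hp0).ne', add_zero]
    exact mono ha fun i => le_add_of_nonneg_right (hb i)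
  have hA' := Real.rpow_pos_of_pos hA p⁻¹
  have hB' := Real.rpow_pos_of_pos hB p⁻¹
  rw [Real.le_rpow_inv_iff_of_pos (add_pos hA' hB').le (nonneg hab) hp0]
  have h := ConvexOn.mul_sum_add_rpow_le (s := Set.Ici 0) (c := -1) (p := p) (fun x hx => hx)
    (fun x hx r hr => div_nonneg hx hr.le)
    ((Real.concaveOn_rpow hp0.le hp.le).neg.congr fun x _ => by simp) ha hb hA' hB'
    (Real.rpow_inv_rpow hA.le hp0.ne').symm (Real.rpow_inv_rpow hB.le hp0.ne').symm
  linarith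

/-- Reverse Minkowski inequality for finite sums, negative exponent. -/
theorem reverse_minkowski_sum_of_neg {ι : Type*} [Fintype ι] [Nonempty ι] {p : ℝ} (hp : p < 0)
    {a b : ι → ℝ} (ha : ∀ i, 0 < a i) (hb : ∀ i, 0 < b i) :
    (∑ i, a i ^ p) ^ p⁻¹ + (∑ i, b i ^ p) ^ p⁻¹ ≤ (∑ i, (a i + b i) ^ p) ^ p⁻¹ := by
  have pos {x : ι → ℝ} (hx : ∀ i, 0 < x i) : 0 < ∑ i, x i ^ p :=
    Finset.sum_pos (fun i _ => Real.rpow_pos_of_pos (hx i) p) Finset.univ_nonempty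
  have hA' := Real.rpow_pos_of_pos (pos ha) p⁻¹
  have hB' := Real.rpow_pos_of_pos (pos hb) p⁻¹
  rw [Real.le_rpow_inv_iff_of_neg (add_pos hA' hB') (pos fun i => add_pos (ha i) (hb i)) hp]
  have h := ConvexOn.mul_sum_add_rpow_le (s := Set.Ioi 0) (c := 1) (p := p)
    (fun x hx => (Set.mem_Ioi.1 hx).le) (fun x hx r hr => div_pos hx hr)
    (by simpa using convexOn_rpow_of_nonpos hp.le) ha hb hA' hB'
    (Real.rpow_inv_rpow (pos ha).le hp.ne).symm (Real.rpow_inv_rpow (pos hb).le hp.ne).symm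
  linarith

section Hermitian

variable {ι : Type*} [Fintype ι] [DecidableEq ι]

theorem hermFC_eq_cfc {f : Matrix ι ι ℂ} (hf : f.IsHermitian) (φ : ℝ → ℝ) :
    hermFC φ f = cfc φ f := by
  rw [hermFC, dif_pos hf, hf.cfc_eq, Matrix.IsHermitian.cfc, Unitary.conjStarAlgAut_apply]
  rfl

theorem trace_hermFC {f : Matrix ι ι ℂ} (hf : f.IsHermitian) (φ : ℝ → ℝ) :
    (hermFC φ f).trace = ∑ i, (φ (hf.eigenvalues i) : ℂ) := by
  rw [hermFC, dif_pos hf, Matrix.trace_mul_comm, ← mul_assoc]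
  simp [Matrix.trace_diagonal]

/-- For a positive semidefinite matrix the Schatten `p`-norm is the normalized `p`-norm of the
eigenvalues. -/
theorem snorm_eq_of_posSemidef_s5 {f : Matrix ι ι ℂ} (hf : f.PosSemidef) (p : ℝ) :
    snorm p f = ((Fintype.card ι : ℝ)⁻¹) ^ p⁻¹ *
      (∑ i, hf.isHermitian.eigenvalues i ^ p) ^ p⁻¹ := by
  have hfs : IsSelfAdjoint f := hf.isHermitian
  have hsq : (fᴴ * f).IsHermitian := Matrix.isHermitian_conjTranspose_mul_self f
  have hcomp : hermFC (fun x => x ^ (p / 2)) (fᴴ * f) =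
      hermFC (fun x => (x ^ 2) ^ (p / 2)) f := by
    rw [hermFC_eq_cfc hsq, hermFC_eq_cfc hf.isHermitian, hf.isHermitian.eq, ← pow_two,
      ← cfc_comp_pow (fun x : ℝ => x ^ (p / 2)) 2 f (Set.Finite.continuousOn ?_ _)]
    exact (Matrix.finite_real_spectrum (A := f)).image _
  rw [snorm, ntrace, mpow, hcomp, trace_hermFC hf.isHermitian, one_div, div_eq_inv_mul,
    Real.mul_rpow (by positivity)]
  · congr 2
    rw [← Complex.ofReal_sum, Complex.ofReal_re]
    refine Finset.sum_congr rfl fun i _ => ?_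
    rw [← Real.rpow_natCast, ← Real.rpow_mul (hf.eigenvalues_nonneg i)]
    congr 1
    push_cast
    ring
  · rw [← Complex.ofReal_sum, Complex.ofReal_re]
    exact Finset.sum_nonneg fun i _ => Real.rpow_nonneg (sq_nonneg _) _

theorem sum_normSq_row_of_mem_unitary {U : Matrix ι ι ℂ} (hU : U ∈ Matrix.unitaryGroup ι ℂ)
    (i : ι) : ∑ j, Complex.normSq (U i j) = 1 := by
  have h := congrFun (congrFun (Matrix.mem_unitaryGroup_iff.1 hU) i) i
  simp only [Matrix.mul_apply, Matrix.star_apply, Matrix.one_apply_eq, Complex.star_def,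
    Complex.mul_conj] at h
  exact_mod_cast h

theorem sum_normSq_col_of_mem_unitary {U : Matrix ι ι ℂ} (hU : U ∈ Matrix.unitaryGroup ι ℂ)
    (j : ι) : ∑ i, Complex.normSq (U i j) = 1 := by
  simpa [Matrix.star_apply] using sum_normSq_row_of_mem_unitary (Unitary.star_mem hU) j

/-- The diagonal entries of a Hermitian matrix in any orthonormal basis are obtained from its
eigenvalues by averaging with a doubly stochastic matrix. -/
theorem exists_diag_conj_eq_sum_eigenvalues {f : Matrix ι ι ℂ} (hf : f.IsHermitian)
    {U : Matrix ι ι ℂ} (hU : U ∈ Matrix.unitaryGroup ι ℂ) :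
    ∃ W : Matrix ι ι ℝ, (∀ i j, 0 ≤ W i j) ∧ (∀ i, ∑ j, W i j = 1) ∧ (∀ j, ∑ i, W i j = 1) ∧
      ∀ i, ((star U * f * U) i i).re = ∑ j, W i j * hf.eigenvalues j := by
  have hV : star U * (hf.eigenvectorUnitary : Matrix ι ι ℂ) ∈ Matrix.unitaryGroup ι ℂ :=
    mul_mem (Unitary.star_mem hU) hf.eigenvectorUnitary.2
  set V := star U * (hf.eigenvectorUnitary : Matrix ι ι ℂ) with hVdef
  refine ⟨Matrix.of fun i j => Complex.normSq (V i j), fun i j => Complex.normSq_nonneg _,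
    sum_normSq_row_of_mem_unitary hV, sum_normSq_col_of_mem_unitary hV, fun i => ?_⟩
  have hconj : star U * f * U =
      V * Matrix.diagonal (fun i => (hf.eigenvalues i : ℂ)) * star V := by
    conv_lhs => rw [hf.spectral_theorem, Unitary.conjStarAlgAut_apply]
    simp only [hVdef, star_mul, star_star, mul_assoc]
    rfl
  rw [hconj, Matrix.mul_apply, Complex.re_sum]
  refine Finset.sum_congr rfl fun j _ => ?_
  rw [Matrix.mul_diagonal, Matrix.star_apply, mul_right_comm, Complex.star_def, Complex.mul_conj,
    ← Complex.ofReal_mul, Complex.ofReal_re, Matrix.of_apply]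

theorem diag_conj_eigenvectorUnitary {f : Matrix ι ι ℂ} (hf : f.IsHermitian) (i : ι) :
    (star (hf.eigenvectorUnitary : Matrix ι ι ℂ) * f * hf.eigenvectorUnitary) i i =
      hf.eigenvalues i := by
  have h := hf.conjStarAlgAut_star_eigenvectorUnitary
  rw [Unitary.conjStarAlgAut_apply] at h
  simpa using congrFun (congrFun h i) i

/-- For `0 < p < 1`, the diagonal of a positive semidefinite matrix in any orthonormal basis has
`p`-norm at least that of the eigenvalues. -/
theorem rpow_sum_eigenvalues_le_of_pos {f : Matrix ι ι ℂ} (hf : f.PosSemidef) {p : ℝ}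
    (hp0 : 0 < p) (hp : p < 1) {U : Matrix ι ι ℂ} (hU : U ∈ Matrix.unitaryGroup ι ℂ) :
    (∀ i, 0 ≤ ((star U * f * U) i i).re) ∧
    (∑ i, hf.isHermitian.eigenvalues i ^ p) ^ p⁻¹ ≤
      (∑ i, ((star U * f * U) i i).re ^ p) ^ p⁻¹ := by
  obtain ⟨W, hW, hrow, hcol, hdiag⟩ := exists_diag_conj_eq_sum_eigenvalues hf.isHermitian hU
  simp_rw [hdiag]
  refine ⟨fun i => Finset.sum_nonneg fun j _ => mul_nonneg (hW i j) (hf.eigenvalues_nonneg j), ?_⟩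
  have h := (Real.concaveOn_rpow hp0.le hp.le).neg.sum_mulVec_le hW hrow hcol hf.eigenvalues_nonneg
  simp only [Pi.neg_apply, Finset.sum_neg_distrib, neg_le_neg_iff] at h
  exact Real.rpow_le_rpow
    (Finset.sum_nonneg fun i _ => Real.rpow_nonneg (hf.eigenvalues_nonneg i) p) h
    (inv_pos.2 hp0).le

/-- For `p < 0`, the diagonal of a positive definite matrix in any orthonormal basis has
`p`-norm at least that of the eigenvalues. -/
theorem rpow_sum_eigenvalues_le_of_neg [Nonempty ι] {f : Matrix ι ι ℂ} (hf : f.PosDef) {p : ℝ}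
    (hp : p < 0) {U : Matrix ι ι ℂ} (hU : U ∈ Matrix.unitaryGroup ι ℂ) :
    (∀ i, 0 < ((star U * f * U) i i).re) ∧
    (∑ i, hf.isHermitian.eigenvalues i ^ p) ^ p⁻¹ ≤
      (∑ i, ((star U * f * U) i i).re ^ p) ^ p⁻¹ := by
  obtain ⟨W, hW, hrow, hcol, hdiag⟩ := exists_diag_conj_eq_sum_eigenvalues hf.isHermitian hU
  simp_rw [hdiag]
  have hpos (i : ι) : 0 < ∑ j, W i j * hf.isHermitian.eigenvalues j := by
    simpa using (convex_Ioi (0 : ℝ)).sum_mem (t := Finset.univ) (w := W i)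
      (z := hf.isHermitian.eigenvalues) (fun j _ => hW i j) (hrow i)
      (fun j _ => hf.eigenvalues_pos j)
  refine ⟨hpos, ?_⟩
  exact Real.rpow_le_rpow_of_nonpos
    (Finset.sum_pos (fun i _ => Real.rpow_pos_of_pos (hpos i) p) Finset.univ_nonempty)
    ((convexOn_rpow_of_nonpos hp.le).sum_mulVec_le hW hrow hcol hf.eigenvalues_pos)
    (inv_lt_zero.2 hp).le

end Hermitian

/-- Reverse Minkowski inequality for matrices. -/
theorem reverse_minkowski
    (d : ℕ) (hd : 0 < d)
    (f g : Matrix (Fin d) (Fin d) ℂ) (hf : f.PosSemidef) (hg : g.PosSemidef)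
    (p : ℝ) (hp : p < 1) (hp0 : p ≠ 0)
    (hfd : p < 0 → f.PosDef) (hgd : p < 0 → g.PosDef) :
    snorm p f + snorm p g ≤ snorm p (f + g) := by
  have : Nonempty (Fin d) := ⟨⟨0, hd⟩⟩
  have hfg : (f + g).PosSemidef := hf.add hg
  rw [snorm_eq_of_posSemidef_s5 hf, snorm_eq_of_posSemidef_s5 hg, snorm_eq_of_posSemidef_s5 hfg, ← mul_add]
  refine mul_le_mul_of_nonneg_left ?_ (by positivity)
  have hU := hfg.isHermitian.eigenvectorUnitary.2
  have hsum (i : Fin d) := congrArg Complex.re (diag_conj_eigenvectorUnitary hfg.isHermitian i)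
  simp only [mul_add, add_mul, Matrix.add_apply, Complex.add_re, Complex.ofReal_re] at hsum
  simp_rw [← hsum]
  rcases lt_or_gt_of_ne hp0 with hneg | hpos
  · obtain ⟨ha, hfa⟩ := rpow_sum_eigenvalues_le_of_neg (hfd hneg) hneg hU
    obtain ⟨hb, hgb⟩ := rpow_sum_eigenvalues_le_of_neg (hgd hneg) hneg hU
    exact (add_le_add hfa hgb).trans (reverse_minkowski_sum_of_neg hneg ha hb)
  · obtain ⟨ha, hfa⟩ := rpow_sum_eigenvalues_le_of_pos hf hpos hp hU
    obtain ⟨hb, hgb⟩ := rpow_sum_eigenvalues_le_of_pos hg hpos hp hU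
    exact (add_le_add hfa hgb).trans (reverse_minkowski_sum_of_pos hpos hp ha hb)
end

section
/- Variational characterization of the Schatten p-'norm' for p < 1: Let f ∈ M_d be positive semidefinite and let p < 1, p ≠ 0 (if p < 0, assume f is positive definite), and let p' = p/(p−1) be the Hölder conjugate of p. Then ‖f‖_p = inf { τ(fg) : g ∈ M_d positive definite, ‖g‖_{p'} ≥ 1 }. -/
open Matrix
open scoped ComplexOrder

section

variable {ι : Type*} [Fintype ι] [DecidableEq ι]

/-- The matrix `U diag(a) U†` for a unitary `U` and a real vector `a`. -/
noncomputable def conjDiag (U : unitary (Matrix ι ι ℂ)) (a : ι → ℝ) : Matrix ι ι ℂ :=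
  U * diagonal (fun i => (a i : ℂ)) * (star U : Matrix ι ι ℂ)

lemma Matrix.IsHermitian.eq_conjDiag {A : Matrix ι ι ℂ} (hA : A.IsHermitian) :
    A = conjDiag hA.eigenvectorUnitary hA.eigenvalues :=
  hA.spectral_theorem

lemma conjDiag_isHermitian (U : unitary (Matrix ι ι ℂ)) (a : ι → ℝ) :
    (conjDiag U a).IsHermitian :=
  isHermitian_mul_mul_conjTranspose _ (isHermitian_diagonal_of_self_adjoint _ (by
    ext i; simp))

lemma conjDiag_mul (U : unitary (Matrix ι ι ℂ)) (a b : ι → ℝ) :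
    conjDiag U a * conjDiag U b = conjDiag U (fun i => a i * b i) := by
  have h : (star U : Matrix ι ι ℂ) * U = 1 := Unitary.coe_star_mul_self U
  calc conjDiag U a * conjDiag U b
      = U * diagonal (fun i => (a i : ℂ)) * ((star U : Matrix ι ι ℂ) * U) *
          diagonal (fun i => (b i : ℂ)) * (star U : Matrix ι ι ℂ) := by
        simp only [conjDiag, mul_assoc]
    _ = conjDiag U (fun i => a i * b i) := by
        rw [h, mul_one, mul_assoc (U : Matrix ι ι ℂ), diagonal_mul_diagonal]
        simp [conjDiag]

lemma trace_conjDiag (U : unitary (Matrix ι ι ℂ)) (a : ι → ℝ) :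
    (conjDiag U a).trace = ∑ i, (a i : ℂ) := by
  have h : (star U : Matrix ι ι ℂ) * U = 1 := Unitary.coe_star_mul_self U
  rw [conjDiag, trace_mul_comm, ← mul_assoc, h, one_mul, trace_diagonal]

lemma ntrace_conjDiag (U : unitary (Matrix ι ι ℂ)) (a : ι → ℝ) :
    ntrace (conjDiag U a) = (∑ i, a i) / Fintype.card ι := by
  rw [ntrace, trace_conjDiag, ← Complex.ofReal_sum, Complex.ofReal_re]

lemma charpoly_conjDiag (U : unitary (Matrix ι ι ℂ)) (a : ι → ℝ) :
    (conjDiag U a).charpoly = (diagonal (fun i => (a i : ℂ))).charpoly := by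
  have h : (star U : Matrix ι ι ℂ) * U = 1 := Unitary.coe_star_mul_self U
  rw [conjDiag, charpoly_mul_comm, ← mul_assoc, h, one_mul]

lemma map_eigenvalues_conjDiag (U : unitary (Matrix ι ι ℂ)) (a : ι → ℝ)
    (h : (conjDiag U a).IsHermitian) :
    Finset.univ.val.map h.eigenvalues = Finset.univ.val.map a := by
  have h1 := h.roots_charpoly_eq_eigenvalues
  rw [charpoly_conjDiag, charpoly_diagonal, Polynomial.roots_prod _ _ (by
    simp [Finset.prod_ne_zero_iff, Polynomial.X_sub_C_ne_zero])] at h1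
  have h2 := congrArg (Multiset.map Complex.re) h1
  simpa [Multiset.map_map, Function.comp_def] using h2.symm

lemma ntrace_hermFC_conjDiag (φ : ℝ → ℝ) (U : unitary (Matrix ι ι ℂ)) (a : ι → ℝ) :
    ntrace (hermFC φ (conjDiag U a)) = (∑ i, φ (a i)) / Fintype.card ι := by
  have h := conjDiag_isHermitian U a
  have h2 := congrArg (fun s => (s.map φ).sum) (map_eigenvalues_conjDiag U a h)
  simp only [Multiset.map_map] at h2
  rw [hermFC, dif_pos h]
  refine (ntrace_conjDiag h.eigenvectorUnitary fun i => φ (h.eigenvalues i)).trans ?_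
  congr 1

lemma snorm_conjDiag (p : ℝ) (U : unitary (Matrix ι ι ℂ)) {a : ι → ℝ} (ha : ∀ i, 0 ≤ a i) :
    snorm p (conjDiag U a) = ((∑ i, a i ^ p) / Fintype.card ι) ^ (1 / p) := by
  rw [snorm, mpow, (conjDiag_isHermitian U a).eq, conjDiag_mul, ntrace_hermFC_conjDiag]
  congr 3 with i
  rw [← pow_two, ← Real.rpow_natCast, ← Real.rpow_mul (ha i)]
  congr 1
  push_cast
  ring

lemma conjDiag_posDef (U : unitary (Matrix ι ι ℂ)) {a : ι → ℝ} (ha : ∀ i, 0 < a i) :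
    (conjDiag U a).PosDef := by
  have h : (diagonal (fun i => (a i : ℂ))).PosDef :=
    PosDef.diagonal fun i => Complex.zero_lt_real.mpr (ha i)
  refine h.mul_mul_conjTranspose_same ?_
  apply vecMul_injective_of_isUnit
  exact (Unitary.toUnits U).isUnit

/-- The trace of a product of two diagonalized matrices is governed by a doubly stochastic
weight. -/
lemma exists_weight_trace_mul (U V : unitary (Matrix ι ι ℂ)) :
    ∃ w : ι → ι → ℝ, (∀ i j, 0 ≤ w i j) ∧ (∀ i, ∑ j, w i j = 1) ∧ (∀ j, ∑ i, w i j = 1) ∧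
      ∀ a b : ι → ℝ, ((conjDiag U a * conjDiag V b).trace).re = ∑ i, ∑ j, w i j * (a i * b j) := by
  set W : unitary (Matrix ι ι ℂ) := star U * V with hW
  refine ⟨fun i j => Complex.normSq ((W : Matrix ι ι ℂ) i j), fun i j => Complex.normSq_nonneg _,
    fun i => ?_, fun j => ?_, fun a b => ?_⟩
  · have h0 : (W : Matrix ι ι ℂ) * star (W : Matrix ι ι ℂ) = 1 := Unitary.coe_mul_star_self W
    have h := congrFun (congrFun h0 i) i
    simp only [mul_apply, star_apply, one_apply_eq, RCLike.star_def, Complex.mul_conj] at h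
    exact_mod_cast h
  · have h0 : star (W : Matrix ι ι ℂ) * (W : Matrix ι ι ℂ) = 1 := Unitary.coe_star_mul_self W
    have h := congrFun (congrFun h0 j) j
    simp only [mul_apply, star_apply, one_apply_eq, RCLike.star_def, mul_comm, Complex.mul_conj] at h
    exact_mod_cast h
  · have h : (conjDiag U a * conjDiag V b).trace =
        (diagonal (fun i => (a i : ℂ)) * (W : Matrix ι ι ℂ) * diagonal (fun i => (b i : ℂ)) *
          (star W : Matrix ι ι ℂ)).trace := by
      rw [conjDiag, conjDiag, hW, mul_assoc, mul_assoc, trace_mul_comm]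
      simp [mul_assoc]
    rw [h, trace]
    have h2 : ∀ i, (diagonal (fun i => (a i : ℂ)) * (W : Matrix ι ι ℂ) *
        diagonal (fun i => (b i : ℂ)) * (star W : Matrix ι ι ℂ)).diag i =
        ((∑ j, Complex.normSq ((W : Matrix ι ι ℂ) i j) * (a i * b j) : ℝ) : ℂ) := by
      intro i
      rw [diag_apply, mul_apply]
      push_cast
      refine Finset.sum_congr rfl fun j _ => ?_
      rw [mul_diagonal, diagonal_mul, star_apply, RCLike.star_def, ← Complex.mul_conj]
      ring
    simp_rw [h2]
    rw [← Complex.ofReal_sum, Complex.ofReal_re]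

end

/-- Weighted reverse Hölder inequality. -/
lemma weighted_reverse_holder {κ : Type*} (s : Finset κ) {w x y : κ → ℝ} {q : ℝ} (hq0 : 0 < q)
    (hq1 : q < 1) (hw : ∀ k, 0 ≤ w k) (hx : ∀ k, 0 ≤ x k) (hy : ∀ k, 0 < y k) :
    ∑ k ∈ s, w k * x k ^ q ≤
      (∑ k ∈ s, w k * y k ^ (q / (q - 1))) ^ (1 - q) * (∑ k ∈ s, w k * (x k * y k)) ^ q := by
  have h := Real.inner_le_weight_mul_Lp_of_nonneg s (one_le_inv_iff₀.2 ⟨hq0, hq1.le⟩)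
    (fun k => w k * y k ^ (q / (q - 1))) (fun k => x k ^ q * y k ^ (-(q / (q - 1))))
    (fun k => mul_nonneg (hw k) (Real.rpow_nonneg (hy k).le _))
    (fun k => mul_nonneg (Real.rpow_nonneg (hx k) _) (Real.rpow_nonneg (hy k).le _))
  have hq : q - 1 ≠ 0 := by linarith
  rw [inv_inv] at h
  convert! h using 2 with k
  · rw [Real.rpow_neg (hy k).le]
    have := (Real.rpow_pos_of_pos (hy k) (q / (q - 1))).ne'
    field_simp
  · congr 1
    refine Finset.sum_congr rfl fun k _ => ?_
    rw [Real.mul_rpow (Real.rpow_nonneg (hx k) _) (Real.rpow_nonneg (hy k).le _),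
      ← Real.rpow_mul (hx k), ← Real.rpow_mul (hy k).le, mul_inv_cancel₀ hq0.ne', Real.rpow_one,
      mul_mul_mul_comm, ← Real.rpow_add (hy k)]
    have : q / (q - 1) + -(q / (q - 1)) * q⁻¹ = 1 := by
      field_simp
      ring
    rw [this, Real.rpow_one, mul_assoc]

/-- Reverse Hölder inequality in the form used for a dual variable of norm at least one. -/
lemma weighted_rpow_le_of_one_le {κ : Type*} (s : Finset κ) {w x y : κ → ℝ} {p : ℝ} (hp0 : p ≠ 0)
    (hp1 : p < 1) (hw : ∀ k, 0 ≤ w k) (hx : ∀ k, 0 ≤ x k) (hxp : p < 0 → ∀ k, 0 < x k)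
    (hy : ∀ k, 0 < y k)
    (h1 : 1 ≤ (∑ k ∈ s, w k * y k ^ (p / (p - 1))) ^ (1 / (p / (p - 1)))) :
    (∑ k ∈ s, w k * x k ^ p) ^ (1 / p) ≤ ∑ k ∈ s, w k * (x k * y k) := by
  have hp : p - 1 ≠ 0 := by linarith
  set A := ∑ k ∈ s, w k * x k ^ p
  set B := ∑ k ∈ s, w k * y k ^ (p / (p - 1))
  set S := ∑ k ∈ s, w k * (x k * y k)
  have hA0 : 0 ≤ A := Finset.sum_nonneg fun k _ => mul_nonneg (hw k) (Real.rpow_nonneg (hx k) _)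
  have hB0 : 0 ≤ B :=
    Finset.sum_nonneg fun k _ => mul_nonneg (hw k) (Real.rpow_nonneg (hy k).le _)
  have hS0 : 0 ≤ S :=
    Finset.sum_nonneg fun k _ => mul_nonneg (hw k) (mul_nonneg (hx k) (hy k).le)
  rcases hp0.lt_or_gt with hneg | hpos
  · set q := p / (p - 1) with hq
    have hq0 : 0 < q := div_pos_of_neg_of_neg hneg (by linarith)
    have hq1 : q < 1 := by
      rw [hq, div_lt_one_of_neg (by linarith)]; linarith
    have hqq : q / (q - 1) = p := by
      have : q - 1 = 1 / (p - 1) := by rw [hq]; field_simp; ring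
      rw [this, hq]; field_simp
    have h := weighted_reverse_holder s hq0 hq1 hw (fun k => (hy k).le) (hxp hneg)
    rw [hqq] at h
    simp only [mul_comm (y _) (x _)] at h
    have h2 := h1.trans (Real.rpow_le_rpow hB0 h (by positivity))
    rw [Real.mul_rpow (Real.rpow_nonneg hA0 _) (Real.rpow_nonneg hS0 _), ← Real.rpow_mul hA0,
      ← Real.rpow_mul hS0, mul_one_div_cancel hq0.ne', Real.rpow_one] at h2
    have he : (1 - q) * (1 / q) = -(1 / p) := by rw [hq]; field_simp; ring
    rw [he, Real.rpow_neg hA0] at h2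
    have hApos : 0 < A ^ (1 / p) := by
      refine (Real.rpow_nonneg hA0 _).lt_of_ne' fun h0 => ?_
      rw [h0] at h2
      norm_num at h2
    rwa [inv_mul_eq_div, one_le_div hApos] at h2
  · have h := weighted_reverse_holder s hpos hp1 hw hx hy
    have h2 := Real.rpow_le_rpow hA0 h (show 0 ≤ 1 / p by positivity)
    rw [Real.mul_rpow (Real.rpow_nonneg hB0 _) (Real.rpow_nonneg hS0 _), ← Real.rpow_mul hB0,
      ← Real.rpow_mul hS0, mul_one_div_cancel hp0, Real.rpow_one] at h2
    have he : (1 - p) * (1 / p) = -(1 / (p / (p - 1))) := by field_simp; ring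
    rw [he, Real.rpow_neg hB0] at h2
    exact h2.trans (mul_le_of_le_one_left hS0 (inv_le_one_of_one_le₀ h1))

section

variable {ι : Type*} [Fintype ι] [DecidableEq ι]

lemma snorm_conjDiag_le_ntrace_mul {U V : unitary (Matrix ι ι ℂ)} {a b : ι → ℝ} {p : ℝ}
    (hp0 : p ≠ 0) (hp1 : p < 1) (ha : ∀ i, 0 ≤ a i) (hap : p < 0 → ∀ i, 0 < a i)
    (hb : ∀ i, 0 < b i) (h1 : 1 ≤ snorm (p / (p - 1)) (conjDiag V b)) :
    snorm p (conjDiag U a) ≤ ntrace (conjDiag U a * conjDiag V b) := by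
  obtain ⟨w, hw, hrow, hcol, htr⟩ := exists_weight_trace_mul U V
  have hx : ∀ φ : ℝ → ℝ, ∑ k : ι × ι, w k.1 k.2 / Fintype.card ι * φ (a k.1) =
      (∑ i, φ (a i)) / Fintype.card ι := by
    intro φ
    simp only [Fintype.sum_prod_type, ← Finset.sum_mul, ← Finset.sum_div, hrow]
    rw [← Finset.mul_sum, one_div_mul_eq_div]
  have hy : ∀ φ : ℝ → ℝ, ∑ k : ι × ι, w k.1 k.2 / Fintype.card ι * φ (b k.2) =
      (∑ i, φ (b i)) / Fintype.card ι := by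
    intro φ
    simp only [Fintype.sum_prod_type_right, ← Finset.sum_mul, ← Finset.sum_div, hcol]
    rw [← Finset.mul_sum, one_div_mul_eq_div]
  rw [snorm_conjDiag _ _ fun i => (hb i).le, ← hy (· ^ (p / (p - 1)))] at h1
  rw [snorm_conjDiag _ _ ha, ← hx (· ^ p), ntrace, htr]
  refine (weighted_rpow_le_of_one_le Finset.univ hp0 hp1
    (fun k : ι × ι => div_nonneg (hw k.1 k.2) (Nat.cast_nonneg _)) (fun k => ha k.1)
    (fun h k => hap h k.1) (fun k => hb k.2) h1).trans_eq ?_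
  simp only [Fintype.sum_prod_type, Finset.sum_div]
  refine Finset.sum_congr rfl fun i _ => Finset.sum_congr rfl fun j _ => ?_
  ring

/-- A near-optimal dual variable for the perturbation `b` of `a`. -/
lemma exists_ntrace_mul_conjDiag_le [Nonempty ι] (U : unitary (Matrix ι ι ℂ)) {a b : ι → ℝ} {p : ℝ}
    (hp0 : p ≠ 0) (hp1 : p < 1) (hab : ∀ i, a i ≤ b i) (hb : ∀ i, 0 < b i) :
    ∃ g : Matrix ι ι ℂ, g.PosDef ∧ 1 ≤ snorm (p / (p - 1)) g ∧
      ntrace (conjDiag U a * g) ≤ ((∑ i, b i ^ p) / Fintype.card ι) ^ (1 / p) := by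
  have hp : p - 1 ≠ 0 := by linarith
  set A := (∑ i, b i ^ p) / Fintype.card ι with hA
  have hA0 : 0 < A := div_pos (Finset.sum_pos (fun i _ => Real.rpow_pos_of_pos (hb i) _)
    Finset.univ_nonempty) (Nat.cast_pos.2 Fintype.card_pos)
  set c := A ^ (-(1 / (p / (p - 1)))) with hc
  have hc0 : 0 < c := Real.rpow_pos_of_pos hA0 _
  have hg0 : ∀ i, 0 < c * b i ^ (p - 1) := fun i => mul_pos hc0 (Real.rpow_pos_of_pos (hb i) _)
  refine ⟨conjDiag U fun i => c * b i ^ (p - 1), conjDiag_posDef U hg0, ?_, ?_⟩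
  · rw [snorm_conjDiag _ _ fun i => (hg0 i).le]
    have h : ∀ i, (c * b i ^ (p - 1)) ^ (p / (p - 1)) = A⁻¹ * b i ^ p := by
      intro i
      rw [Real.mul_rpow hc0.le (Real.rpow_nonneg (hb i).le _), ← Real.rpow_mul (hb i).le, hc,
        ← Real.rpow_mul hA0.le, mul_div_cancel₀ _ hp, neg_mul, one_div_mul_cancel
        (div_ne_zero hp0 hp), Real.rpow_neg_one]
    simp_rw [h]
    rw [← Finset.mul_sum, mul_div_assoc, ← hA, inv_mul_cancel₀ hA0.ne', Real.one_rpow]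
  · rw [conjDiag_mul, ntrace_conjDiag]
    have h : A ^ (1 / p) = c * A := by
      rw [hc, ← Real.rpow_add_one hA0.ne']
      congr 1
      field_simp
      ring
    rw [h, hA, ← mul_div_assoc, Finset.mul_sum]
    refine div_le_div_of_nonneg_right (Finset.sum_le_sum fun i _ => ?_) (Nat.cast_nonneg _)
    calc a i * (c * b i ^ (p - 1)) ≤ b i * (c * b i ^ (p - 1)) :=
          mul_le_mul_of_nonneg_right (hab i) (hg0 i).le
      _ = c * b i ^ p := by
          rw [Real.rpow_sub_one (hb i).ne']
          have := (hb i).ne'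
          field_simp

end

/-- Variational characterization of the Schatten p-'norm' for `p < 1`. -/
theorem snorm_variational
    (d : ℕ) (hd : 0 < d)
    (f : Matrix (Fin d) (Fin d) ℂ) (hf : f.PosSemidef)
    (p p' : ℝ) (hp : p < 1) (hp0 : p ≠ 0) (hfd : p < 0 → f.PosDef)
    (hp' : p' = p / (p - 1)) :
    snorm p f = sInf {r : ℝ | ∃ g : Matrix (Fin d) (Fin d) ℂ,
      g.PosDef ∧ 1 ≤ snorm p' g ∧ r = ntrace (f * g)} := by
  subst hp'
  have : Nonempty (Fin d) := ⟨⟨0, hd⟩⟩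
  set a := hf.isHermitian.eigenvalues
  have ha : ∀ i, 0 ≤ a i := hf.eigenvalues_nonneg
  have hap : p < 0 → ∀ i, 0 < a i := fun h => (hfd h).eigenvalues_pos
  have hfa : f = conjDiag hf.isHermitian.eigenvectorUnitary a := hf.isHermitian.eq_conjDiag
  generalize hf.isHermitian.eigenvectorUnitary = U at hfa
  clear_value a
  subst hfa
  have hlb : ∀ r ∈ {r : ℝ | ∃ g : Matrix (Fin d) (Fin d) ℂ,
      g.PosDef ∧ 1 ≤ snorm (p / (p - 1)) g ∧ r = ntrace (conjDiag U a * g)},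
      snorm p (conjDiag U a) ≤ r := by
    rintro r ⟨g, hg, hg1, rfl⟩
    rw [hg.isHermitian.eq_conjDiag] at hg1 ⊢
    exact snorm_conjDiag_le_ntrace_mul hp0 hp ha hap hg.eigenvalues_pos hg1
  have hbound := fun ε (hε : (0 : ℝ) < ε) => exists_ntrace_mul_conjDiag_le U (a := a)
    (b := fun i => a i + ε) hp0 hp (fun i => le_add_of_nonneg_right hε.le)
    fun i => add_pos_of_nonneg_of_pos (ha i) hε
  refine le_antisymm (le_csInf ?_ hlb) ?_
  · obtain ⟨g, hg, hg1, -⟩ := hbound 1 one_pos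
    exact ⟨_, g, hg, hg1, rfl⟩
  · rw [snorm_conjDiag _ _ ha]
    have hcont : ContinuousAt (fun ε : ℝ =>
        ((∑ i, (a i + ε) ^ p) / (Fintype.card (Fin d) : ℝ)) ^ (1 / p)) 0 := by
      refine ContinuousAt.rpow_const (ContinuousAt.div_const (tendsto_finsetSum _ fun i _ =>
        ContinuousAt.rpow_const (by fun_prop) ?_) _) ?_
      · rcases hp0.lt_or_gt with h | h
        · exact Or.inl (by simpa using (hap h i).ne')
        · exact Or.inr h.le
      · rcases hp0.lt_or_gt with h | h
        · refine Or.inl (div_pos (Finset.sum_pos (fun i _ => Real.rpow_pos_of_pos ?_ _)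
            Finset.univ_nonempty) (Nat.cast_pos.2 Fintype.card_pos)).ne'
          simpa using hap h i
        · exact Or.inr (by positivity)
    have hlim := hcont.tendsto.mono_left (nhdsWithin_le_nhds (s := Set.Ioi 0))
    simp only [add_zero] at hlim
    refine ge_of_tendsto hlim ?_
    filter_upwards [self_mem_nhdsWithin] with ε hε
    obtain ⟨g, hg, hg1, hle⟩ := hbound ε hε
    exact (csInf_le ⟨_, hlb⟩ ⟨g, hg, hg1, rfl⟩).trans hle
end

section
/- Trace Jensen inequality for unital channels: Let T : M_d → M_d be a unital quantum channel with Kraus decomposition T(f) = Σ_α A_α f A_α† where Σ_α A_α A_α† = I. If φ : [0,∞) → ℝ is convex, then for every positive semidefinite f ∈ M_d, Tr φ(T(f)) ≤ Tr T(φ(f)), where φ is applied via the functional calculus; if φ is concave the inequality is reversed. -/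
open Matrix
open scoped ComplexOrder

/-- The weights `∑ α, |(V† A_α U)_{ij}|²` relating two orthonormal bases through
a family of Kraus operators. -/
noncomputable def krausWeight {ι κ : Type*} [Fintype ι] [Fintype κ] (A : κ → Matrix ι ι ℂ)
    (U V : Matrix ι ι ℂ) (i j : ι) : ℝ :=
  ∑ α, Complex.normSq ((Vᴴ * A α * U) i j)

lemma krausWeight_nonneg {ι κ : Type*} [Fintype ι] [Fintype κ] (A : κ → Matrix ι ι ℂ)
    (U V : Matrix ι ι ℂ) (i j : ι) : 0 ≤ krausWeight A U V i j :=
  Finset.sum_nonneg fun _ _ => Complex.normSq_nonneg _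

lemma mul_diagonal_mul_conjTranspose_apply_self {ι : Type*} [Fintype ι] [DecidableEq ι]
    (B : Matrix ι ι ℂ) (c : ι → ℝ) (i : ι) :
    (B * diagonal (fun j => (c j : ℂ)) * Bᴴ) i i =
      ((∑ j, Complex.normSq (B i j) * c j : ℝ) : ℂ) := by
  rw [Matrix.mul_apply]
  push_cast
  refine Finset.sum_congr rfl fun j _ => ?_
  rw [mul_diagonal, conjTranspose_apply, Complex.star_def, mul_right_comm, Complex.mul_conj]

lemma conj_kraus_diagonal_apply_self {ι κ : Type*} [Fintype ι] [DecidableEq ι] [Fintype κ]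
    (A : κ → Matrix ι ι ℂ) (U V : Matrix ι ι ℂ) (c : ι → ℝ) (i : ι) :
    (Vᴴ * (∑ α, A α * (U * diagonal (fun j => (c j : ℂ)) * Uᴴ) * (A α)ᴴ) * V) i i =
      ((∑ j, krausWeight A U V i j * c j : ℝ) : ℂ) := by
  have h : Vᴴ * (∑ α, A α * (U * diagonal (fun j => (c j : ℂ)) * Uᴴ) * (A α)ᴴ) * V =
      ∑ α, (Vᴴ * A α * U) * diagonal (fun j => (c j : ℂ)) * (Vᴴ * A α * U)ᴴ := by
    simp only [Finset.mul_sum, Finset.sum_mul, conjTranspose_mul, conjTranspose_conjTranspose,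
      Matrix.mul_assoc]
  rw [h, Matrix.sum_apply]
  simp only [mul_diagonal_mul_conjTranspose_apply_self, krausWeight, Finset.sum_mul]
  rw [← Complex.ofReal_sum, Finset.sum_comm]

lemma Matrix.IsHermitian.eq_mul_diagonal_mul_s8 {ι : Type*} [Fintype ι] [DecidableEq ι]
    {f : Matrix ι ι ℂ} (hf : f.IsHermitian) :
    f = (hf.eigenvectorUnitary : Matrix ι ι ℂ) *
      diagonal (fun i => (hf.eigenvalues i : ℂ)) * (hf.eigenvectorUnitary : Matrix ι ι ℂ)ᴴ := by
  conv_lhs => rw [hf.spectral_theorem]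
  rfl

lemma hermFC_eq {ι : Type*} [Fintype ι] [DecidableEq ι]
    {f : Matrix ι ι ℂ} (hf : f.IsHermitian) (φ : ℝ → ℝ) :
    hermFC φ f = (hf.eigenvectorUnitary : Matrix ι ι ℂ) *
      diagonal (fun i => (φ (hf.eigenvalues i) : ℂ)) *
        (hf.eigenvectorUnitary : Matrix ι ι ℂ)ᴴ := by
  rw [hermFC, dif_pos hf]
  rfl

lemma coe_unitary_mul_conjTranspose {ι : Type*} [Fintype ι] [DecidableEq ι]
    (V : unitaryGroup ι ℂ) : (V : Matrix ι ι ℂ) * (V : Matrix ι ι ℂ)ᴴ = 1 :=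
  Unitary.mul_star_self_of_mem V.2

lemma conjTranspose_mul_coe_unitary {ι : Type*} [Fintype ι] [DecidableEq ι]
    (V : unitaryGroup ι ℂ) : (V : Matrix ι ι ℂ)ᴴ * (V : Matrix ι ι ℂ) = 1 :=
  Unitary.star_mul_self_of_mem V.2

lemma trace_conj_unitary {ι : Type*} [Fintype ι] [DecidableEq ι]
    (V : unitaryGroup ι ℂ) (M : Matrix ι ι ℂ) :
    ((V : Matrix ι ι ℂ)ᴴ * M * (V : Matrix ι ι ℂ)).trace = M.trace := by
  rw [trace_mul_comm, ← Matrix.mul_assoc, coe_unitary_mul_conjTranspose, Matrix.one_mul]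

lemma hermFC_trace_re {ι : Type*} [Fintype ι] [DecidableEq ι]
    {f : Matrix ι ι ℂ} (hf : f.IsHermitian) (φ : ℝ → ℝ) :
    (hermFC φ f).trace.re = ∑ i, φ (hf.eigenvalues i) := by
  rw [hermFC_eq hf, trace_mul_comm, ← Matrix.mul_assoc, conjTranspose_mul_coe_unitary,
    Matrix.one_mul, trace_diagonal, Complex.re_sum]
  simp

lemma hermFC_neg {ι : Type*} [Fintype ι] [DecidableEq ι] (φ : ℝ → ℝ) {f : Matrix ι ι ℂ}
    (hf : f.IsHermitian) : hermFC (-φ) f = -hermFC φ f := by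
  rw [hermFC_eq hf, hermFC_eq hf, ← Matrix.neg_mul, ← Matrix.mul_neg, diagonal_neg]
  simp

lemma isHermitian_kraus_apply {ι κ : Type*} [Fintype ι] [Fintype κ]
    (A : κ → Matrix ι ι ℂ) {f : Matrix ι ι ℂ} (hf : f.IsHermitian) :
    (∑ α, A α * f * (A α)ᴴ).IsHermitian := by
  simp only [Matrix.IsHermitian, conjTranspose_sum, conjTranspose_mul,
    conjTranspose_conjTranspose, hf.eq, Matrix.mul_assoc]

/-- Trace Jensen inequality for unital completely positive maps; trace preservation plays no
role. -/
lemma trace_hermFC_kraus_le {ι κ : Type*} [Fintype ι] [DecidableEq ι] [Fintype κ]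
    (A : κ → Matrix ι ι ℂ) (hUnital : ∑ α, A α * (A α)ᴴ = 1)
    {f : Matrix ι ι ℂ} (hf : f.PosSemidef) {φ : ℝ → ℝ} (hφ : ConvexOn ℝ (Set.Ici 0) φ) :
    (hermFC φ (∑ α, A α * f * (A α)ᴴ)).trace.re ≤
      (∑ α, A α * hermFC φ f * (A α)ᴴ).trace.re := by
  have hg := isHermitian_kraus_apply A hf.isHermitian
  set U := hf.isHermitian.eigenvectorUnitary with hU
  set V := hg.eigenvectorUnitary with hV
  have key := conj_kraus_diagonal_apply_self A (U : Matrix ι ι ℂ) (V : Matrix ι ι ℂ)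
  have hsum (i : ι) : ∑ j, krausWeight A (U : Matrix ι ι ℂ) (V : Matrix ι ι ℂ) i j = 1 := by
    have h := key (fun _ => 1) i
    simp only [Complex.ofReal_one, diagonal_one, mul_one,
      coe_unitary_mul_conjTranspose, hUnital, conjTranspose_mul_coe_unitary, one_apply_eq] at h
    exact_mod_cast h.symm
  have heig (i : ι) : hg.eigenvalues i =
      ∑ j, krausWeight A (U : Matrix ι ι ℂ) (V : Matrix ι ι ℂ) i j *
        hf.isHermitian.eigenvalues j := by
    have h := key hf.isHermitian.eigenvalues i
    rw [hU, ← hf.isHermitian.eq_mul_diagonal_mul_s8] at h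
    have h' : (V : Matrix ι ι ℂ)ᴴ * (∑ α, A α * f * (A α)ᴴ) * (V : Matrix ι ι ℂ) =
        diagonal (fun i => (hg.eigenvalues i : ℂ)) := by
      conv_lhs => rw [hg.eq_mul_diagonal_mul_s8]
      rw [← hV, Matrix.mul_assoc, Matrix.mul_assoc, Matrix.mul_assoc,
        conjTranspose_mul_coe_unitary, Matrix.mul_one, ← Matrix.mul_assoc,
        conjTranspose_mul_coe_unitary, Matrix.one_mul]
    rw [h', diagonal_apply_eq] at h
    exact_mod_cast h
  have htr : (∑ α, A α * hermFC φ f * (A α)ᴴ).trace.re =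
      ∑ i, ∑ j, krausWeight A (U : Matrix ι ι ℂ) (V : Matrix ι ι ℂ) i j *
        φ (hf.isHermitian.eigenvalues j) := by
    rw [← trace_conj_unitary V, hermFC_eq hf.isHermitian, Matrix.trace, Complex.re_sum]
    refine Finset.sum_congr rfl fun i _ => ?_
    rw [diag_apply, ← hU, key fun j => φ (hf.isHermitian.eigenvalues j), Complex.ofReal_re]
  rw [htr, hermFC_trace_re hg]
  refine Finset.sum_le_sum fun i _ => ?_
  rw [heig i]
  exact hφ.map_sum_le (fun j _ => krausWeight_nonneg A _ _ i j) (hsum i)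
    fun j _ => hf.eigenvalues_nonneg j

/-- Trace Jensen inequality for unital quantum channels given in Kraus form
`T(f) = Σ_α A_α f A_α†` with `Σ_α A_α† A_α = I` (trace preservation) and
`Σ_α A_α A_α† = I` (unitality). -/
theorem trace_jensen_unital
    (d : ℕ) (hd : 0 < d) (m : ℕ)
    (A : Fin m → Matrix (Fin d) (Fin d) ℂ)
    (hTP : ∑ α, (A α)ᴴ * A α = 1) (hUnital : ∑ α, A α * (A α)ᴴ = 1)
    (f : Matrix (Fin d) (Fin d) ℂ) (hf : f.PosSemidef)
    (φ : ℝ → ℝ) :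
    (ConvexOn ℝ (Set.Ici 0) φ →
      (hermFC φ (∑ α, A α * f * (A α)ᴴ)).trace.re ≤
        (∑ α, A α * hermFC φ f * (A α)ᴴ).trace.re) ∧
    (ConcaveOn ℝ (Set.Ici 0) φ →
      (∑ α, A α * hermFC φ f * (A α)ᴴ).trace.re ≤
        (hermFC φ (∑ α, A α * f * (A α)ᴴ)).trace.re) := by
  refine ⟨trace_hermFC_kraus_le A hUnital hf, fun hφ => ?_⟩
  have h := trace_hermFC_kraus_le A hUnital hf hφ.neg
  rw [hermFC_neg φ hf.isHermitian, hermFC_neg φ (isHermitian_kraus_apply A hf.isHermitian)] at h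
  simpa only [Matrix.mul_neg, Matrix.neg_mul, Finset.sum_neg_distrib, trace_neg, Complex.neg_re,
    neg_le_neg_iff] using h
end

section
/- Two-point generalized Stroock–Varopoulos inequality: Let p, q be real numbers with p ≥ q, p, q ∈ (0,2] and p ≠ 1, q ≠ 1, and let p' = p/(p−1), q' = q/(q−1) be their Hölder conjugates. Then for all x, y ≥ 0 (with x, y > 0 if needed to make negative powers well-defined; taking the convention 0^a = 0 for a > 0 and interpreting x^{1/p'} for p' < 0 only at x > 0, the inequality holds for all x, y > 0): p p' (x^{1/p} − y^{1/p})(x^{1/p'} − y^{1/p'}) ≤ q q' (x^{1/q} − y^{1/q})(x^{1/q'} − y^{1/q'}). -/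
open Matrix
open scoped ComplexOrder

/-- Expanding `cosh` in its power series shows that `w ↦ cosh (√w * t)` is convex. -/
theorem convexOn_cosh_sqrt_mul (t : ℝ) :
    ConvexOn ℝ (Set.Ici 0) fun w : ℝ => Real.cosh (√w * t) := by
  have hsum : ∀ w : ℝ, 0 ≤ w →
      HasSum (fun n : ℕ => w ^ n * (t ^ (2 * n) / ((2 * n).factorial : ℝ)))
        (Real.cosh (√w * t)) := by
    intro w hw
    refine (Real.hasSum_cosh (√w * t)).congr_fun fun n => ?_
    rw [mul_pow, pow_mul √w, Real.sq_sqrt hw, mul_div_assoc]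
  refine ⟨convex_Ici 0, fun v hv w hw a b ha hb hab => ?_⟩
  have hvw := convex_Ici (0 : ℝ) hv hw ha hb hab
  refine hasSum_le (fun n => ?_) (hsum _ hvw)
    (((hsum v hv).mul_left a).add ((hsum w hw).mul_left b))
  have hpow := (convexOn_pow n).2 hv hw ha hb hab
  have hcoeff : 0 ≤ t ^ (2 * n) / ((2 * n).factorial : ℝ) :=
    div_nonneg ((even_two_mul n).pow_nonneg t) (Nat.cast_nonneg _)
  calc _ ≤ (a • v ^ n + b • w ^ n) * (t ^ (2 * n) / ((2 * n).factorial : ℝ)) :=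
        mul_le_mul_of_nonneg_right hpow hcoeff
    _ = _ := by simp only [smul_eq_mul]; ring

/-- The two-point Dirichlet form is a multiple of a secant slope of `w ↦ cosh (√w * t)` based
at `1`, where `t = (log x - log y) / 2`. -/
theorem two_point_dirichlet_eq_secant {p x y : ℝ} (hp0 : 0 < p) (hp2 : p ≤ 2) (hp1 : p ≠ 1)
    (hx : 0 < x) (hy : 0 < y) :
    p * (p / (p - 1)) * ((x ^ (1 / p) - y ^ (1 / p)) *
        (x ^ (1 / (p / (p - 1))) - y ^ (1 / (p / (p - 1))))) =
      8 * Real.exp ((Real.log x + Real.log y) / 2) *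
        ((Real.cosh (√((2 / p - 1) ^ 2) * ((Real.log x - Real.log y) / 2)) -
            Real.cosh (√1 * ((Real.log x - Real.log y) / 2))) /
          ((2 / p - 1) ^ 2 - 1)) := by
  have hp1' : p - 1 ≠ 0 := sub_ne_zero.2 hp1
  have hu : 0 ≤ 2 / p - 1 := by
    rw [sub_nonneg, le_div_iff₀ hp0]
    linarith
  rw [Real.sqrt_sq hu, Real.sqrt_one, one_mul]
  have hconj : 1 / (p / (p - 1)) = 1 - 1 / p := by field_simp
  have hcoeff : p * (p / (p - 1)) = -4 / ((2 / p - 1) ^ 2 - 1) := by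
    have hden : (2 / p - 1) ^ 2 - 1 = -4 * (p - 1) / p ^ 2 := by
      field_simp
      ring
    rw [hden]
    field_simp
  have hprod : (x ^ (1 / p) - y ^ (1 / p)) * (x ^ (1 - 1 / p) - y ^ (1 - 1 / p)) =
      2 * Real.exp ((Real.log x + Real.log y) / 2) *
        (Real.cosh ((Real.log x - Real.log y) / 2) -
          Real.cosh ((2 / p - 1) * ((Real.log x - Real.log y) / 2))) := by
    simp only [Real.rpow_def_of_pos hx, Real.rpow_def_of_pos hy, Real.cosh_eq]
    generalize Real.log x = l
    generalize Real.log y = m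
    have hrhs : ∀ s a b c d : ℝ, 2 * Real.exp s * ((Real.exp a + Real.exp b) / 2 -
        (Real.exp c + Real.exp d) / 2) = Real.exp (s + a) + Real.exp (s + b) -
          Real.exp (s + c) - Real.exp (s + d) := by
      intro s a b c d
      simp only [Real.exp_add]
      ring
    rw [hrhs]
    simp only [sub_mul, mul_sub, ← Real.exp_add]
    ring_nf
  rw [hconj, hcoeff, hprod]
  ring

/-- Two-point generalized Stroock–Varopoulos inequality. -/
theorem two_point_stroock_varopoulos
    (p q p' q' : ℝ) (hq0 : 0 < q) (hqp : q ≤ p) (hp2 : p ≤ 2)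
    (hp1 : p ≠ 1) (hq1 : q ≠ 1)
    (hp' : p' = p / (p - 1)) (hq' : q' = q / (q - 1))
    (x y : ℝ) (hx : 0 < x) (hy : 0 < y) :
    p * p' * ((x ^ (1/p) - y ^ (1/p)) * (x ^ (1/p') - y ^ (1/p'))) ≤
      q * q' * ((x ^ (1/q) - y ^ (1/q)) * (x ^ (1/q') - y ^ (1/q'))) := by
  have hp0 : 0 < p := hq0.trans_le hqp
  subst hp' hq'
  rw [two_point_dirichlet_eq_secant hp0 hp2 hp1 hx hy,
    two_point_dirichlet_eq_secant hq0 (hqp.trans hp2) hq1 hx hy]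
  have hne : ∀ r : ℝ, 0 < r → r ≠ 1 → (2 / r - 1) ^ 2 ≠ 1 := by
    intro r hr hr1 h
    have h2 : (2 / r) * (1 / r - 1) = 0 := by linear_combination h / 2
    rcases mul_eq_zero.1 h2 with h0 | h0
    · exact (div_pos two_pos hr).ne' h0
    · exact hr1 (by field_simp at h0; linarith)
  have hle : (2 / p - 1) ^ 2 ≤ (2 / q - 1) ^ 2 := by
    have hu : 0 ≤ 2 / p - 1 := by
      rw [sub_nonneg, le_div_iff₀ hp0]
      linarith
    gcongr
  exact mul_le_mul_of_nonneg_left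
    ((convexOn_cosh_sqrt_mul _).secant_mono (Set.mem_Ici.2 zero_le_one)
      (Set.mem_Ici.2 (sq_nonneg _)) (Set.mem_Ici.2 (sq_nonneg _))
      (hne p hp0 hp1) (hne q hq0 hq1) hle) (by positivity)
end

section
/- Quantum Stroock–Varopoulos inequality: Let T : M_d → M_d be a unital, reversible, primitive quantum channel, let c₀ > 0, and let L = c₀(id − T) be the generator of the associated semigroup. Then for all real p ≥ q with p, q ∈ (0,2] \ {1} and every positive semidefinite g ∈ M_d (positive definite where negative matrix powers are required), p p' · E_L(g^{1/p'}, g^{1/p}) ≤ q q' · E_L(g^{1/q'}, g^{1/q}), where p' = p/(p−1) and q' = q/(q−1) are the Hölder conjugates. -/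
open Matrix
open scoped ComplexOrder

/-- The function `v ↦ cosh (x √v)` is convex on the nonnegative half-line. -/
lemma convexOn_cosh_mul_sqrt (x : ℝ) :
    ConvexOn ℝ (Set.Ici 0) (fun v : ℝ => Real.cosh (x * √v)) := by
  have hsum : ∀ v : ℝ, 0 ≤ v → HasSum
      (fun n : ℕ => x ^ (2 * n) / (Nat.factorial (2 * n) : ℝ) * v ^ n)
      (Real.cosh (x * √v)) := by
    intro v hv
    convert Real.hasSum_cosh (x * √v) using 2 with n
    rw [mul_pow, pow_mul (√v), Real.sq_sqrt hv]
    ring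
  refine ⟨convex_Ici 0, fun v hv w hw a b ha hb hab => ?_⟩
  have hvw : 0 ≤ a • v + b • w := convex_Ici (0 : ℝ) hv hw ha hb hab
  refine hasSum_le (fun n => ?_) (hsum _ hvw)
    (((hsum v hv).mul_left a).add ((hsum w hw).mul_left b))
  have hpow := (convexOn_pow (𝕜 := ℝ) n).2 hv hw ha hb hab
  simp only [smul_eq_mul] at hpow ⊢
  have hcoef : 0 ≤ x ^ (2 * n) / (Nat.factorial (2 * n) : ℝ) :=
    div_nonneg ((even_two_mul n).pow_nonneg x) (by positivity)
  linarith [mul_le_mul_of_nonneg_left hpow hcoef]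

lemma cosh_sub_cosh_div_mono (x : ℝ) {u v : ℝ} (hu : 0 ≤ u) (huv : u ≤ v)
    (hu1 : u ≠ 1) (hv1 : v ≠ 1) :
    (Real.cosh x - Real.cosh (x * u)) / (1 - u ^ 2) ≤
      (Real.cosh x - Real.cosh (x * v)) / (1 - v ^ 2) := by
  have hv : 0 ≤ v := hu.trans huv
  have h := (convexOn_cosh_mul_sqrt x).secant_mono (a := 1) (x := u ^ 2) (y := v ^ 2)
    (by simp) (sq_nonneg u) (sq_nonneg v)
    (by simpa [pow_eq_one_iff_of_nonneg hu] using hu1)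
    (by simpa [pow_eq_one_iff_of_nonneg hv] using hv1) (by gcongr)
  simp only [Real.sqrt_sq hu, Real.sqrt_sq hv, Real.sqrt_one, mul_one] at h
  rwa [← neg_div_neg_eq, ← neg_div_neg_eq (_ - _) (1 - v ^ 2), neg_sub, neg_sub, neg_sub, neg_sub]

lemma exp_rpow_sub_mul_exp_rpow_sub (x y s : ℝ) :
    (Real.exp x ^ (1 - s) - Real.exp y ^ (1 - s)) * (Real.exp x ^ s - Real.exp y ^ s) =
      2 * Real.exp ((x + y) / 2) *
        (Real.cosh ((x - y) / 2) - Real.cosh ((x - y) / 2 * (2 * s - 1))) := by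
  simp only [← Real.exp_mul, Real.cosh_eq, sub_mul, mul_sub, mul_div_assoc', mul_add, add_div,
    ← Real.exp_add, mul_assoc]
  ring_nf

/-- The two-point Stroock–Varopoulos inequality. -/
lemma rpow_sub_mul_rpow_sub_div_mono {a b s t : ℝ} (ha : 0 ≤ a) (hb : 0 ≤ b)
    (hs : 1 / 2 ≤ s) (hst : s ≤ t) (hs1 : s ≠ 1) (ht1 : t ≠ 1)
    (hpos : 1 < t → 0 < a ∧ 0 < b) :
    (a ^ (1 - s) - b ^ (1 - s)) * (a ^ s - b ^ s) / (s * (1 - s)) ≤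
      (a ^ (1 - t) - b ^ (1 - t)) * (a ^ t - b ^ t) / (t * (1 - t)) := by
  have hs0 : 0 < s := by linarith
  have ht0 : 0 < t := by linarith
  by_cases hab : 0 < a ∧ 0 < b
  · obtain ⟨ha, hb⟩ := hab
    have hc := cosh_sub_cosh_div_mono ((Real.log a - Real.log b) / 2)
      (u := 2 * s - 1) (v := 2 * t - 1) (by linarith) (by linarith)
      (fun h => hs1 (by linarith)) (fun h => ht1 (by linarith))
    have key : ∀ r : ℝ, (a ^ (1 - r) - b ^ (1 - r)) * (a ^ r - b ^ r) / (r * (1 - r)) =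
        8 * Real.exp ((Real.log a + Real.log b) / 2) *
          ((Real.cosh ((Real.log a - Real.log b) / 2) -
            Real.cosh ((Real.log a - Real.log b) / 2 * (2 * r - 1))) / (1 - (2 * r - 1) ^ 2)) := by
      intro r
      have h := exp_rpow_sub_mul_exp_rpow_sub (Real.log a) (Real.log b) r
      rw [Real.exp_log ha, Real.exp_log hb] at h
      rw [h, show 1 - (2 * r - 1) ^ 2 = 4 * (r * (1 - r)) by ring]
      generalize r * (1 - r) = z
      ring
    rw [key, key]
    gcongr
  · have htlt : t < 1 := lt_of_le_of_ne (not_lt.mp fun h => hab (hpos h)) ht1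
    have hslt : s < 1 := hst.trans_lt htlt
    have hzero : ∀ c r : ℝ, 0 ≤ c → 0 < r → r < 1 →
        c ^ (1 - r) * c ^ r = c := fun c r hc hr hr1 => by
      rw [← Real.rpow_add_of_nonneg hc (by linarith) hr.le]; simp
    have hmono : ∀ c : ℝ, 0 ≤ c → c / (s * (1 - s)) ≤ c / (t * (1 - t)) := by
      intro c hc
      apply div_le_div_of_nonneg_left hc (mul_pos ht0 (by linarith))
      nlinarith
    rcases ha.eq_or_lt with h | h
    · subst h
      rw [Real.zero_rpow hs0.ne', Real.zero_rpow ht0.ne', Real.zero_rpow (by linarith),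
        Real.zero_rpow (by linarith), zero_sub, zero_sub, zero_sub, zero_sub, neg_mul_neg,
        neg_mul_neg, hzero b s hb hs0 hslt, hzero b t hb ht0 htlt]
      exact hmono b hb
    · obtain rfl : b = 0 := le_antisymm (not_lt.mp fun h' => hab ⟨h, h'⟩) hb
      rw [Real.zero_rpow hs0.ne', Real.zero_rpow ht0.ne', Real.zero_rpow (by linarith),
        Real.zero_rpow (by linarith), sub_zero, sub_zero, sub_zero, sub_zero,
        hzero a s ha hs0 hslt, hzero a t ha ht0 htlt]
      exact hmono a ha

lemma IsCompletelyPositive.posSemidef {ι : Type*} [Fintype ι] [DecidableEq ι]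
    {T : Matrix ι ι ℂ → Matrix ι ι ℂ} (hT : IsCompletelyPositive T)
    {A : Matrix ι ι ℂ} (hA : A.PosSemidef) : (T A).PosSemidef :=
  (hT 1 (A.submatrix Prod.snd Prod.snd) (hA.submatrix _)).submatrix (fun i : ι => ((0 : Fin 1), i))

/-- The rank-one spectral projection onto the `j`-th column of the unitary `U`. -/
def colProj {ι : Type*} [Fintype ι] [DecidableEq ι] (U : Matrix.unitaryGroup ι ℂ) (j : ι) :
    Matrix ι ι ℂ :=
  (U : Matrix ι ι ℂ) * Matrix.diagonal (Pi.single j 1) * (star U : Matrix ι ι ℂ)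

section colProj

variable {ι : Type*} [Fintype ι] [DecidableEq ι] (U : Matrix.unitaryGroup ι ℂ)

lemma sum_smul_colProj (c : ι → ℂ) :
    ∑ j, c j • colProj U j =
      (U : Matrix ι ι ℂ) * Matrix.diagonal c * (star U : Matrix ι ι ℂ) := by
  have hc : Matrix.diagonal c = ∑ j, c j • Matrix.diagonal (Pi.single j (1 : ℂ)) := by
    ext i k
    by_cases hik : i = k <;> simp [Matrix.sum_apply, hik, Pi.single_apply]
  rw [hc, Finset.mul_sum, Finset.sum_mul]
  simp [colProj]

lemma sum_colProj : ∑ j, colProj U j = 1 := by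
  simpa using sum_smul_colProj U (fun _ => 1)

lemma posSemidef_colProj (j : ι) : (colProj U j).PosSemidef := by
  have h : (Matrix.diagonal (Pi.single j (1 : ℂ)) : Matrix ι ι ℂ).PosSemidef :=
    Matrix.PosSemidef.diagonal (Pi.single_nonneg.mpr zero_le_one)
  exact h.mul_mul_conjTranspose_same (U : Matrix ι ι ℂ)

lemma trace_colProj_mul (j : ι) (A : Matrix ι ι ℂ) :
    (colProj U j * A).trace = ((U : Matrix ι ι ℂ)ᴴ * A * (U : Matrix ι ι ℂ)) j j := by
  rw [colProj, Matrix.mul_assoc, Matrix.mul_assoc, Matrix.trace_mul_comm, Matrix.mul_assoc]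
  simp [Matrix.trace, Matrix.diagonal_mul, Pi.single_apply, Matrix.star_eq_conjTranspose]

lemma trace_colProj_mul_colProj (i j : ι) :
    (colProj U i * colProj U j).trace = if i = j then 1 else 0 := by
  have h : (U : Matrix ι ι ℂ)ᴴ * U = 1 := Unitary.coe_star_mul_self U
  have h' : (U : Matrix ι ι ℂ)ᴴ * colProj U j * (U : Matrix ι ι ℂ) = Matrix.diagonal (Pi.single j 1) := by
    rw [colProj, Matrix.star_eq_conjTranspose]
    simp only [Matrix.mul_assoc, h, Matrix.mul_one]
    rw [← Matrix.mul_assoc, h, Matrix.one_mul]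
  rw [trace_colProj_mul, h']
  simp [Pi.single_apply]

end colProj

lemma half_sum_mul_sub_mul_sub {ι : Type*} [Fintype ι] (w : ι → ι → ℝ)
    (hsymm : ∀ i j, w i j = w j i) (hw : ∀ j, ∑ i, w i j = 1) (a b : ι → ℝ) :
    (∑ i, a i * b i) - ∑ i, ∑ j, a i * b j * w i j =
      (∑ i, ∑ j, w i j * ((a i - a j) * (b i - b j))) / 2 := by
  have h1 : ∑ i, ∑ j, w i j * (a i * b i) = ∑ i, a i * b i := by
    refine Finset.sum_congr rfl fun i _ => ?_
    rw [← Finset.sum_mul, Finset.sum_congr rfl fun j _ => hsymm i j, hw, one_mul]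
  have h2 : ∑ i, ∑ j, w i j * (a j * b j) = ∑ i, a i * b i := by
    rw [Finset.sum_comm]
    refine Finset.sum_congr rfl fun i _ => ?_
    rw [← Finset.sum_mul, hw, one_mul]
  have h3 : ∑ i, ∑ j, a j * b i * w i j = ∑ i, ∑ j, a i * b j * w i j := by
    rw [Finset.sum_comm]
    simp only [hsymm]
  have h4 : ∑ i, ∑ j, w i j * ((a i - a j) * (b i - b j)) =
      ∑ i, ∑ j, w i j * (a i * b i) + ∑ i, ∑ j, w i j * (a j * b j) -
        ∑ i, ∑ j, a j * b i * w i j - ∑ i, ∑ j, a i * b j * w i j := by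
    simp only [← Finset.sum_add_distrib, ← Finset.sum_sub_distrib]
    refine Finset.sum_congr rfl fun i _ => Finset.sum_congr rfl fun j _ => ?_
    ring
  rw [h4, h1, h2, h3]
  ring

/-- On functions of a fixed Hermitian matrix, the Dirichlet form of a reversible channel is a
classical Dirichlet form on the eigenvalues. -/
lemma exists_dirichlet_hermFC_eq {ι : Type*} [Fintype ι] [DecidableEq ι]
    {T : Matrix ι ι ℂ → Matrix ι ι ℂ} (hT : IsQChannel T) (hTrev : IsReversible T)
    {c : ℝ} (hc : 0 ≤ c) {g : Matrix ι ι ℂ} (hg : g.IsHermitian) :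
    ∃ w : ι → ι → ℝ, (∀ i j, 0 ≤ w i j) ∧ ∀ φ ψ : ℝ → ℝ,
      dirichlet (fun f => (c : ℂ) • (f - T f)) (hermFC φ g) (hermFC ψ g) =
        ∑ i, ∑ j, w i j * ((φ (hg.eigenvalues i) - φ (hg.eigenvalues j)) *
          (ψ (hg.eigenvalues i) - ψ (hg.eigenvalues j))) := by
  obtain ⟨hlin, hcp, htr⟩ := hT
  set U := hg.eigenvectorUnitary
  set w : ι → ι → ℝ := fun i j => (colProj U i * T (colProj U j)).trace.re with hw
  have hw0 : ∀ i j, 0 ≤ w i j := fun i j => by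
    have h := ((hcp.posSemidef (posSemidef_colProj U j)).conjTranspose_mul_mul_same
      (U : Matrix ι ι ℂ)).diag_nonneg (i := i)
    simp only [hw, trace_colProj_mul]
    exact (Complex.nonneg_iff.mp h).1
  have hsymm : ∀ i j, w i j = w j i := fun i j => by
    simp only [hw]
    rw [hTrev, Matrix.trace_mul_comm]
  have hw1 : ∀ j, ∑ i, w i j = 1 := fun j => by
    have htrace : (colProj U j).trace = 1 := by
      rw [← Matrix.one_mul (colProj U j), ← sum_colProj U, Finset.sum_mul, Matrix.trace_sum]
      simp [trace_colProj_mul_colProj]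
    simp only [hw]
    rw [← Complex.re_sum, ← Matrix.trace_sum, ← Finset.sum_mul, sum_colProj, Matrix.one_mul,
      htr, htrace, Complex.one_re]
  refine ⟨fun i j => c / (2 * Fintype.card ι) * w i j,
    fun i j => mul_nonneg (by positivity) (hw0 i j), fun φ ψ => ?_⟩
  have hFC : ∀ χ : ℝ → ℝ, hermFC χ g = ∑ j, (χ (hg.eigenvalues j) : ℂ) • colProj U j := by
    intro χ
    rw [sum_smul_colProj, hermFC, dif_pos hg]
  have hTsum : ∀ χ : ℝ → ℝ, T (hermFC χ g) =
      ∑ j, (χ (hg.eigenvalues j) : ℂ) • T (colProj U j) := by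
    intro χ
    rw [hFC]
    exact (map_sum (hlin.mk' T) _ _).trans (Finset.sum_congr rfl fun j _ => hlin.map_smul _ _)
  have hA : (hermFC φ g * hermFC ψ g).trace.re =
      ∑ i, φ (hg.eigenvalues i) * ψ (hg.eigenvalues i) := by
    rw [hFC, hFC]
    simp only [Finset.sum_mul, Finset.mul_sum, Matrix.trace_sum, Matrix.smul_mul,
      Matrix.mul_smul, Matrix.trace_smul, trace_colProj_mul_colProj]
    simp [mul_comm]
  have hB : (hermFC φ g * T (hermFC ψ g)).trace.re =
      ∑ i, ∑ j, φ (hg.eigenvalues i) * ψ (hg.eigenvalues j) * w i j := by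
    rw [hTsum, hFC]
    simp only [Finset.sum_mul, Finset.mul_sum, Matrix.trace_sum, Matrix.smul_mul,
      Matrix.mul_smul, Matrix.trace_smul, Complex.re_sum, smul_eq_mul, Complex.re_ofReal_mul, hw]
    rw [Finset.sum_comm]
    exact Finset.sum_congr rfl fun i _ => Finset.sum_congr rfl fun j _ => by ring
  have h := half_sum_mul_sub_mul_sub w hsymm hw1 (fun i => φ (hg.eigenvalues i))
    (fun i => ψ (hg.eigenvalues i))
  rw [← hA, ← hB] at h
  have hD : dirichlet (fun f => (c : ℂ) • (f - T f)) (hermFC φ g) (hermFC ψ g) =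
      c * ((hermFC φ g * hermFC ψ g).trace.re - (hermFC φ g * T (hermFC ψ g)).trace.re) /
        Fintype.card ι := by
    simp [dirichlet, ntrace, Matrix.mul_sub, Matrix.trace_sub]
  rw [hD, h]
  simp only [mul_assoc, ← Finset.mul_sum]
  rw [mul_comm (2 : ℝ), ← div_div]
  ring

/-- Quantum Stroock–Varopoulos inequality. -/
theorem quantum_stroock_varopoulos
    (d : ℕ) (hd : 0 < d)
    (T : Matrix (Fin d) (Fin d) ℂ → Matrix (Fin d) (Fin d) ℂ)
    (hT : IsQChannel T) (hTu : T 1 = 1) (hTrev : IsReversible T)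
    (hTprim : IsPrimitive T)
    (c₀ : ℝ) (hc₀ : 0 < c₀)
    (L : Matrix (Fin d) (Fin d) ℂ → Matrix (Fin d) (Fin d) ℂ)
    (hL : L = fun g => (c₀ : ℂ) • (g - T g))
    (p q p' q' : ℝ) (hq0 : 0 < q) (hqp : q ≤ p) (hp2 : p ≤ 2)
    (hp1 : p ≠ 1) (hq1 : q ≠ 1)
    (hp' : p' = p / (p - 1)) (hq' : q' = q / (q - 1))
    (g : Matrix (Fin d) (Fin d) ℂ) (hg : g.PosSemidef) (hgd : q < 1 → g.PosDef) :
    p * p' * dirichlet L (mpow g (1/p')) (mpow g (1/p)) ≤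
      q * q' * dirichlet L (mpow g (1/q')) (mpow g (1/q)) := by
  subst hL
  have hp0 : 0 < p := hq0.trans_le hqp
  obtain ⟨w, hw0, hw⟩ := exists_dirichlet_hermFC_eq hT hTrev hc₀.le hg.isHermitian
  have hconj : ∀ r : ℝ, 0 < r → r ≠ 1 → 1 / (r / (r - 1)) = 1 - 1 / r ∧
      r * (r / (r - 1)) = (1 / r * (1 - 1 / r))⁻¹ := fun r hr hr1 => by
    have hr1' : r - 1 ≠ 0 := sub_ne_zero.mpr hr1
    constructor <;> field_simp
  obtain ⟨hp'', hpp⟩ := hconj p hp0 hp1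
  obtain ⟨hq'', hqq⟩ := hconj q hq0 hq1
  rw [hp', hq', hp'', hq'', hpp, hqq]
  simp only [mpow, hw, Finset.mul_sum]
  refine Finset.sum_le_sum fun i _ => Finset.sum_le_sum fun j _ => ?_
  rw [mul_left_comm, mul_left_comm _ (w i j), inv_mul_eq_div, inv_mul_eq_div]
  refine mul_le_mul_of_nonneg_left ?_ (hw0 i j)
  refine rpow_sub_mul_rpow_sub_div_mono (hg.eigenvalues_nonneg i) (hg.eigenvalues_nonneg j)
    (one_div_le_one_div_of_le hp0 hp2) (one_div_le_one_div_of_le hq0 hqp)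
    (by simpa using hp1) (by simpa using hq1) fun h => ?_
  have hpd := hgd ((one_lt_div hq0).mp h)
  exact ⟨hpd.eigenvalues_pos i, hpd.eigenvalues_pos j⟩
end

section
/- p-log-Sobolev inequalities from the 2-log-Sobolev inequality: Let T : M_d → M_d be a unital, reversible, primitive quantum channel, let c₀ > 0, and let L = c₀(id − T). Assume the semigroup generated by L satisfies a 2-log-Sobolev inequality with constant α > 0, i.e. Ent(f²) ≤ α E_L(f,f) for all positive semidefinite f ∈ M_d. Then for every p ∈ (0,2] with p ≠ 1 and every positive semidefinite f ∈ M_d (positive definite where negative matrix powers are required), Ent(f^p) ≤ (α p²/(4(p−1))) · E_L(f^{p−1}, f). -/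
open Matrix
open scoped ComplexOrder

lemma convexOn_sinh_Ici : ConvexOn ℝ (Set.Ici 0) Real.sinh := by
  refine MonotoneOn.convexOn_of_deriv (convex_Ici 0) Real.continuous_sinh.continuousOn
    Real.differentiable_sinh.differentiableOn ?_
  intro x hx y hy hxy
  rw [interior_Ici] at hx hy
  have hx' : (0 : ℝ) < x := hx
  have hy' : (0 : ℝ) < y := hy
  rw [Real.deriv_sinh, Real.cosh_le_cosh, abs_of_pos hx', abs_of_pos hy']
  exact hxy

/-- `sinh t / t` is nondecreasing on the nonnegative half-line. -/
lemma mul_sinh_mul_le_mul_sinh_mul {a b u : ℝ} (hb : 0 ≤ b) (hba : b ≤ a) (hu : 0 ≤ u) :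
    a * Real.sinh (b * u) ≤ b * Real.sinh (a * u) := by
  rcases (hb.trans hba).eq_or_lt with ha | ha
  · obtain rfl : b = 0 := le_antisymm (ha ▸ hba) hb
    simp [← ha]
  have h := convexOn_sinh_Ici.2 (Set.mem_Ici.2 le_rfl)
    (Set.mem_Ici.2 (mul_nonneg ha.le hu)) (show 0 ≤ 1 - b / a by rw [sub_nonneg]; exact (div_le_one ha).2 hba)
    (show 0 ≤ b / a by positivity) (by ring)
  have e : b / a * (a * u) = b * u := by field_simp
  simp only [smul_eq_mul, mul_zero, zero_add, Real.sinh_zero, e] at h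
  calc a * Real.sinh (b * u) ≤ a * (b / a * Real.sinh (a * u)) := by gcongr
    _ = b * Real.sinh (a * u) := by field_simp

/-- The scalar Stroock–Varopoulos inequality in hyperbolic form. -/
lemma sinh_sq_le_mul_sinh_mul_sinh {p u : ℝ} (hp0 : 0 < p) (hp2 : p ≤ 2) (hp1 : p ≠ 1)
    (hu : 0 ≤ u) :
    Real.sinh (p / 2 * u) ^ 2 ≤
      p ^ 2 / (4 * (p - 1)) * (Real.sinh ((p - 1) * u) * Real.sinh u) := by
  have hid : Real.sinh ((p - 1) * u) * Real.sinh u =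
      Real.sinh (p / 2 * u) ^ 2 - Real.sinh ((1 - p / 2) * u) ^ 2 := by
    have e1 : (p - 1) * u = p / 2 * u - (1 - p / 2) * u := by ring
    have e2 : Real.sinh u = Real.sinh (p / 2 * u + (1 - p / 2) * u) := by congr 1; ring
    rw [e2, e1, Real.sinh_sub, Real.sinh_add]
    have h1 := Real.cosh_sq (p / 2 * u)
    have h2 := Real.cosh_sq ((1 - p / 2) * u)
    linear_combination (- Real.sinh ((1 - p / 2) * u) ^ 2) * h1 +
      (Real.sinh (p / 2 * u) ^ 2) * h2
  rw [hid]
  have hA : 0 ≤ Real.sinh (p / 2 * u) := Real.sinh_nonneg_iff.2 (by positivity)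
  have hB : 0 ≤ Real.sinh ((1 - p / 2) * u) :=
    Real.sinh_nonneg_iff.2 (mul_nonneg (by linarith) hu)
  rcases lt_or_gt_of_ne hp1 with h | h
  · have hm := mul_sinh_mul_le_mul_sinh_mul (a := 1 - p / 2) (b := p / 2) (by positivity)
      (by linarith) hu
    have hsq := pow_le_pow_left₀ (mul_nonneg (by linarith) hA) hm 2
    rw [div_mul_eq_mul_div (p ^ 2), le_div_iff_of_neg (by linarith)]
    nlinarith [hsq]
  · have hm := mul_sinh_mul_le_mul_sinh_mul (a := p / 2) (b := 1 - p / 2) (by linarith)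
      (by linarith) hu
    have hsq := pow_le_pow_left₀ (mul_nonneg (by positivity) hB) hm 2
    rw [div_mul_eq_mul_div (p ^ 2), le_div_iff₀ (by linarith)]
    nlinarith [hsq]

lemma exp_sub_exp_eq_sinh (v w : ℝ) :
    Real.exp v - Real.exp w = 2 * Real.exp ((v + w) / 2) * Real.sinh ((v - w) / 2) := by
  rw [Real.sinh_eq]
  have h1 : Real.exp v = Real.exp ((v + w) / 2) * Real.exp ((v - w) / 2) := by
    rw [← Real.exp_add]; congr 1; ring
  have h2 : Real.exp w = Real.exp ((v + w) / 2) * Real.exp (-((v - w) / 2)) := by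
    rw [← Real.exp_add]; congr 1; ring
  linear_combination h1 - h2

/-- The scalar Stroock–Varopoulos inequality. -/
lemma rpow_half_sub_sq_le {p x y : ℝ} (hp0 : 0 < p) (hp2 : p ≤ 2) (hp1 : p ≠ 1)
    (hx : 0 ≤ x) (hy : 0 ≤ y) (hpos : p < 1 → 0 < x ∧ 0 < y) :
    (x ^ (p / 2) - y ^ (p / 2)) ^ 2 ≤
      p ^ 2 / (4 * (p - 1)) * ((x ^ (p - 1) - y ^ (p - 1)) * (x - y)) := by
  wlog hyx : y ≤ x generalizing x y
  · have := this hy hx (fun h => (hpos h).symm) (le_of_not_ge hyx)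
    calc _ = (y ^ (p / 2) - x ^ (p / 2)) ^ 2 := by ring
      _ ≤ _ := this
      _ = _ := by ring
  rcases hy.eq_or_lt with rfl | hy
  · have h1 : 1 < p := lt_of_le_of_ne (not_lt.1 fun h => (hpos h).2.false) hp1.symm
    rcases hx.eq_or_lt with rfl | hx
    · simp
    have e1 : x ^ (p - 1) * x = x ^ p := by
      rw [← Real.rpow_add_one hx.ne']; congr 1; ring
    have e2 : (x ^ (p / 2)) ^ 2 = x ^ p := by
      rw [← Real.rpow_natCast, ← Real.rpow_mul hx.le]; congr 1; push_cast; ring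
    rw [Real.zero_rpow (by linarith), Real.zero_rpow (by linarith), sub_zero, sub_zero, sub_zero,
      e1, e2]
    refine le_mul_of_one_le_left (by positivity) ?_
    rw [one_le_div (by linarith)]
    nlinarith [sq_nonneg (p - 2)]
  have hx : 0 < x := hy.trans_le hyx
  have hlog : Real.log y ≤ Real.log x := Real.log_le_log hy hyx
  set u := (Real.log x - Real.log y) / 2 with hu
  set s := Real.log x + Real.log y with hs
  have key (a : ℝ) : x ^ a - y ^ a = 2 * Real.exp (a * s / 2) * Real.sinh (a * u) := by
    rw [Real.rpow_def_of_pos hx, Real.rpow_def_of_pos hy, exp_sub_exp_eq_sinh]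
    have e1 : (Real.log x * a + Real.log y * a) / 2 = a * s / 2 := by rw [hs]; ring
    have e2 : (Real.log x * a - Real.log y * a) / 2 = a * u := by rw [hu]; ring
    rw [e1, e2]
  have h := sinh_sq_le_mul_sinh_mul_sinh hp0 hp2 hp1 (u := u) (by linarith)
  have k1 := key 1
  rw [Real.rpow_one, Real.rpow_one, one_mul, one_mul] at k1
  rw [key, key, k1]
  have e : Real.exp (p / 2 * s / 2) ^ 2 = Real.exp ((p - 1) * s / 2) * Real.exp (s / 2) := by
    rw [← Real.exp_nat_mul, ← Real.exp_add]; congr 1; push_cast; ring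
  calc _ = 4 * Real.exp (p / 2 * s / 2) ^ 2 * Real.sinh (p / 2 * u) ^ 2 := by ring
    _ ≤ 4 * Real.exp (p / 2 * s / 2) ^ 2 *
        (p ^ 2 / (4 * (p - 1)) * (Real.sinh ((p - 1) * u) * Real.sinh u)) := by gcongr
    _ = _ := by rw [e]; ring

section SpectralProjections

variable {ι : Type*} [Fintype ι] [DecidableEq ι]

lemma IsCompletelyPositive.posSemidef_s12 {T : Matrix ι ι ℂ → Matrix ι ι ℂ}
    (hT : IsCompletelyPositive T) {g : Matrix ι ι ℂ} (hg : g.PosSemidef) :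
    (T g).PosSemidef :=
  (hT 1 (g.submatrix Prod.snd Prod.snd) (hg.submatrix _)).submatrix fun i => (0, i)

/-- The rank-one spectral projection onto the `i`-th eigenvector. -/
noncomputable def Matrix.IsHermitian.eigenProj {f : Matrix ι ι ℂ} (hf : f.IsHermitian) (i : ι) :
    Matrix ι ι ℂ :=
  vecMulVec (fun k => (hf.eigenvectorUnitary : Matrix ι ι ℂ) k i)
    (star fun k => (hf.eigenvectorUnitary : Matrix ι ι ℂ) k i)

lemma hermFC_eq_sum {f : Matrix ι ι ℂ} (hf : f.IsHermitian) (φ : ℝ → ℝ) :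
    hermFC φ f = ∑ i, (φ (hf.eigenvalues i) : ℂ) • hf.eigenProj i := by
  rw [hermFC, dif_pos hf]
  ext k l
  rw [Matrix.mul_apply, Matrix.sum_apply]
  refine Finset.sum_congr rfl fun i _ => ?_
  simp [Matrix.IsHermitian.eigenProj, vecMulVec_apply, Matrix.star_apply]
  ring

lemma hermFC_mul {f : Matrix ι ι ℂ} (hf : f.IsHermitian) (φ ψ : ℝ → ℝ) :
    hermFC φ f * hermFC ψ f = hermFC (fun x => φ x * ψ x) f := by
  simp only [hermFC, dif_pos hf]
  have hU : (star hf.eigenvectorUnitary : Matrix ι ι ℂ) *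
      (hf.eigenvectorUnitary : Matrix ι ι ℂ) = 1 := Unitary.coe_star_mul_self _
  simp only [Complex.ofReal_mul, ← Matrix.diagonal_mul_diagonal]
  simp only [Matrix.mul_assoc]
  rw [← Matrix.mul_assoc (star _) (hf.eigenvectorUnitary : Matrix ι ι ℂ), hU, Matrix.one_mul]

lemma hermFC_one {f : Matrix ι ι ℂ} (hf : f.IsHermitian) : hermFC (fun _ => 1) f = 1 := by
  simp [hermFC, dif_pos hf]

lemma hermFC_id {f : Matrix ι ι ℂ} (hf : f.IsHermitian) : hermFC (fun x => x) f = f := by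
  rw [hermFC, dif_pos hf]
  conv_rhs => rw [hf.spectral_theorem]
  rfl

lemma hermFC_posSemidef {f : Matrix ι ι ℂ} (hf : f.IsHermitian) {φ : ℝ → ℝ}
    (hφ : ∀ i, 0 ≤ φ (hf.eigenvalues i)) : (hermFC φ f).PosSemidef := by
  rw [hermFC_eq_sum hf]
  refine Matrix.posSemidef_sum _ fun i _ => ?_
  exact (Matrix.posSemidef_vecMulVec_self_star _).smul (by exact_mod_cast hφ i)

/-- The transition weights of `T` in the eigenbasis of `f`. -/
noncomputable def Matrix.IsHermitian.transition {f : Matrix ι ι ℂ} (hf : f.IsHermitian)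
    (T : Matrix ι ι ℂ → Matrix ι ι ℂ) (i j : ι) : ℝ :=
  (hf.eigenProj i * T (hf.eigenProj j)).trace.re

lemma transition_nonneg {f : Matrix ι ι ℂ} (hf : f.IsHermitian)
    {T : Matrix ι ι ℂ → Matrix ι ι ℂ} (hT : IsCompletelyPositive T) (i j : ι) :
    0 ≤ hf.transition T i j := by
  have h := (hT.posSemidef_s12 (g := hf.eigenProj j)
    (Matrix.posSemidef_vecMulVec_self_star _)).dotProduct_mulVec_nonneg
      (fun k => (hf.eigenvectorUnitary : Matrix ι ι ℂ) k i)
  rw [Matrix.IsHermitian.transition, Matrix.IsHermitian.eigenProj, Matrix.vecMulVec_mul,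
    Matrix.trace_vecMulVec, dotProduct_comm, ← Matrix.dotProduct_mulVec]
  exact (Complex.le_def.1 h).1

lemma transition_comm {f : Matrix ι ι ℂ} (hf : f.IsHermitian)
    {T : Matrix ι ι ℂ → Matrix ι ι ℂ} (hT : IsReversible T) (i j : ι) :
    hf.transition T i j = hf.transition T j i := by
  rw [Matrix.IsHermitian.transition, hT, Matrix.trace_mul_comm, Matrix.IsHermitian.transition]

lemma trace_hermFC_mul_map_hermFC {f : Matrix ι ι ℂ} (hf : f.IsHermitian)
    {T : Matrix ι ι ℂ → Matrix ι ι ℂ} (hT : IsLinearMap ℂ T) (φ ψ : ℝ → ℝ) :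
    (hermFC φ f * T (hermFC ψ f)).trace.re =
      ∑ i, ∑ j, φ (hf.eigenvalues i) * ψ (hf.eigenvalues j) * hf.transition T i j := by
  have hTs : T (hermFC ψ f) =
      ∑ j, (ψ (hf.eigenvalues j) : ℂ) • T (hf.eigenProj j) := by
    rw [hermFC_eq_sum hf]
    refine (map_sum hT.mk' _ Finset.univ).trans ?_
    exact Finset.sum_congr rfl fun j _ => hT.map_smul _ _
  rw [hTs, hermFC_eq_sum hf, Finset.sum_mul_sum, Matrix.trace_sum, Complex.re_sum]
  refine Finset.sum_congr rfl fun i _ => ?_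
  rw [Matrix.trace_sum, Complex.re_sum]
  refine Finset.sum_congr rfl fun j _ => ?_
  rw [smul_mul_smul_comm, Matrix.trace_smul, ← Complex.ofReal_mul, smul_eq_mul,
    Complex.re_ofReal_mul, Matrix.IsHermitian.transition]

/-- The Dirichlet form of `c • (id - T)` on functions of `f`, written as a quadratic form in
differences of eigenvalues. -/
lemma dirichlet_hermFC {f : Matrix ι ι ℂ} (hf : f.IsHermitian)
    {T : Matrix ι ι ℂ → Matrix ι ι ℂ} (hT : IsLinearMap ℂ T) (hTu : T 1 = 1)
    (hTrev : IsReversible T) (c : ℝ) (φ ψ : ℝ → ℝ) :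
    dirichlet (fun g => (c : ℂ) • (g - T g)) (hermFC φ f) (hermFC ψ f) =
      c / (2 * Fintype.card ι) * ∑ i, ∑ j, hf.transition T i j *
        ((φ (hf.eigenvalues i) - φ (hf.eigenvalues j)) *
          (ψ (hf.eigenvalues i) - ψ (hf.eigenvalues j))) := by
  have hdiag : (hermFC φ f * hermFC ψ f).trace.re = ∑ i, ∑ j,
      φ (hf.eigenvalues i) * ψ (hf.eigenvalues i) * hf.transition T i j := by
    rw [hermFC_mul hf]
    have h := trace_hermFC_mul_map_hermFC hf hT (fun x => φ x * ψ x) fun _ => 1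
    rw [hermFC_one hf, hTu, Matrix.mul_one] at h
    simpa using h
  have hswap (F : ι → ι → ℝ) : ∑ i, ∑ j, F i j * hf.transition T i j =
      ∑ i, ∑ j, F j i * hf.transition T i j := by
    rw [Finset.sum_comm]
    exact Finset.sum_congr rfl fun i _ => Finset.sum_congr rfl fun j _ => by
      rw [transition_comm hf hTrev]
  have hoff := trace_hermFC_mul_map_hermFC hf hT φ ψ
  have hdiag' := hswap fun i _ => φ (hf.eigenvalues i) * ψ (hf.eigenvalues i)
  have hoff' := hswap fun i j => φ (hf.eigenvalues i) * ψ (hf.eigenvalues j)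
  have hsum : ∑ i, ∑ j, hf.transition T i j *
        ((φ (hf.eigenvalues i) - φ (hf.eigenvalues j)) *
          (ψ (hf.eigenvalues i) - ψ (hf.eigenvalues j))) =
      2 * ((hermFC φ f * hermFC ψ f).trace.re - (hermFC φ f * T (hermFC ψ f)).trace.re) := by
    have hexp : ∑ i, ∑ j, hf.transition T i j *
        ((φ (hf.eigenvalues i) - φ (hf.eigenvalues j)) *
          (ψ (hf.eigenvalues i) - ψ (hf.eigenvalues j))) =
        (∑ i, ∑ j, φ (hf.eigenvalues i) * ψ (hf.eigenvalues i) * hf.transition T i j) +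
        (∑ i, ∑ j, φ (hf.eigenvalues j) * ψ (hf.eigenvalues j) * hf.transition T i j) -
        (∑ i, ∑ j, φ (hf.eigenvalues i) * ψ (hf.eigenvalues j) * hf.transition T i j) -
        (∑ i, ∑ j, φ (hf.eigenvalues j) * ψ (hf.eigenvalues i) * hf.transition T i j) := by
      simp only [← Finset.sum_add_distrib, ← Finset.sum_sub_distrib]
      exact Finset.sum_congr rfl fun i _ => Finset.sum_congr rfl fun j _ => by ring
    rw [hexp, hdiag, hoff, ← hdiag', ← hoff']
    ring
  rw [hsum, dirichlet, ntrace, Matrix.mul_smul, Matrix.mul_sub, Matrix.trace_smul,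
    Matrix.trace_sub, smul_eq_mul, Complex.re_ofReal_mul, Complex.sub_re]
  rw [mul_comm 2 (Fintype.card ι : ℝ), ← div_div]
  ring

end SpectralProjections

/-- p-log-Sobolev inequalities from the 2-log-Sobolev inequality. -/
theorem p_log_sobolev_from_two_log_sobolev
    (d : ℕ) (hd : 0 < d)
    (T : Matrix (Fin d) (Fin d) ℂ → Matrix (Fin d) (Fin d) ℂ)
    (hT : IsQChannel T) (hTu : T 1 = 1) (hTrev : IsReversible T)
    (hTprim : IsPrimitive T)
    (c₀ : ℝ) (hc₀ : 0 < c₀)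
    (L : Matrix (Fin d) (Fin d) ℂ → Matrix (Fin d) (Fin d) ℂ)
    (hL : L = fun g => (c₀ : ℂ) • (g - T g))
    (α : ℝ) (hα : 0 < α)
    (hLSI : ∀ g : Matrix (Fin d) (Fin d) ℂ, g.PosSemidef →
      mEnt (g * g) ≤ α * dirichlet L g g)
    (p : ℝ) (hp0 : 0 < p) (hp2 : p ≤ 2) (hp1 : p ≠ 1)
    (f : Matrix (Fin d) (Fin d) ℂ) (hf : f.PosSemidef) (hfd : p < 1 → f.PosDef) :
    mEnt (mpow f p) ≤ α * p^2 / (4 * (p - 1)) * dirichlet L (mpow f (p-1)) f := by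
  have hH := hf.isHermitian
  have hev := hf.eigenvalues_nonneg
  have hsq : mpow f (p / 2) * mpow f (p / 2) = mpow f p := by
    rw [mpow, hermFC_mul hH, mpow, hermFC_eq_sum hH, hermFC_eq_sum hH]
    refine Finset.sum_congr rfl fun i _ => ?_
    rw [← Real.rpow_add_of_nonneg (hev i) (by positivity) (by positivity), add_halves]
  have hent := hLSI (mpow f (p / 2))
    (hermFC_posSemidef hH fun i => Real.rpow_nonneg (hev i) _)
  rw [hsq] at hent
  refine hent.trans ?_
  have hE1 := dirichlet_hermFC hH hT.1 hTu hTrev c₀ (fun x => x ^ (p / 2)) (fun x => x ^ (p / 2))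
  have hE2 := dirichlet_hermFC hH hT.1 hTu hTrev c₀ (fun x => x ^ (p - 1)) (fun x => x)
  rw [hermFC_id hH] at hE2
  rw [hL, mpow, mpow, hE1, hE2, mul_div_assoc, mul_assoc]
  refine mul_le_mul_of_nonneg_left ?_ hα.le
  rw [mul_left_comm]
  refine mul_le_mul_of_nonneg_left ?_ (by positivity)
  rw [Finset.mul_sum]
  refine Finset.sum_le_sum fun i _ => ?_
  rw [Finset.mul_sum]
  refine Finset.sum_le_sum fun j _ => ?_
  rw [← sq, mul_left_comm]
  exact mul_le_mul_of_nonneg_left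
    (rpow_half_sub_sq_le hp0 hp2 hp1 (hev i) (hev j) fun h =>
      ⟨(hfd h).eigenvalues_pos i, (hfd h).eigenvalues_pos j⟩)
    (transition_nonneg hH hT.2.1 i j)
end
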